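/- Let n ≥ 2 be an integer, let Ω ⊆ ℝⁿ be an unbounded open set containing the complement of the ball B_R(0) for some R > 0, and let u ∈ C¹(Ω) be a weak solution of −Δₙu = e^{u} on Ω with ∫_Ω e^{u} dx < ∞. Then there exist γ_∞ > nⁿωₙ, R' ≥ R and C > 0 such that |u(x) + (γ_∞/(nωₙ))^{1/(n−1)} log|x|| ≤ C for all x ∈ ℝⁿ with |x| ≥ R'. -/

import Mathlib

open MeasureTheory Metric Filter Topology Real Set
open scoped InnerProductSpace

/-- The Lebesgue volume of the unit ball in `ℝⁿ`. -/
noncomputable def omegaN (n : ℕ) : ℝ :=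
  (volume (ball (0 : EuclideanSpace ℝ (Fin n)) 1)).toReal

/-- `c_γ = sign γ * (|γ| / (n ωₙ))^{1/(n-1)}`. -/
noncomputable def cgamma (n : ℕ) (γ : ℝ) : ℝ :=
  Real.sign γ * (|γ| / ((n : ℝ) * omegaN n)) ^ ((1 : ℝ) / ((n : ℝ) - 1))

/-- `u` is a weak solution of `-Δₙ u = f` on `U`. -/
def IsWeakNSol (n : ℕ) (U : Set (EuclideanSpace ℝ (Fin n)))
    (u f : EuclideanSpace ℝ (Fin n) → ℝ) : Prop :=
  ∀ φ : EuclideanSpace ℝ (Fin n) → ℝ, ContDiff ℝ 1 φ → HasCompactSupport φ →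
    tsupport φ ⊆ U →
    ∫ x in U, ‖gradient u x‖ ^ (n - 2) * ⟪gradient u x, gradient φ x⟫_ℝ
      = ∫ x in U, f x * φ x

section NLaplace

variable {n : ℕ}

local notation "𝔼" => EuclideanSpace ℝ (Fin n)

/-- The weak form of `-Δₙ u` tested against `φ`. -/
noncomputable def nPairing (u φ : 𝔼 → ℝ) : ℝ :=
  ∫ x, ‖gradient u x‖ ^ (n - 2) * fderiv ℝ φ x (gradient u x)

/-- `u` is a weak solution of `-Δₙ u = f` on `U`, with integrals over the whole space. -/
def WeakSol (U : Set 𝔼) (u f : 𝔼 → ℝ) : Prop :=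
  ∀ φ : 𝔼 → ℝ, ContDiff ℝ 1 φ → HasCompactSupport φ → tsupport φ ⊆ U →
    nPairing u φ = ∫ x, f x * φ x

lemma WeakSol.mono {U V : Set 𝔼} {u f : 𝔼 → ℝ} (h : WeakSol U u f) (hV : V ⊆ U) :
    WeakSol V u f := fun φ h1 h2 h3 => h φ h1 h2 (h3.trans hV)

lemma contDiff_of_zero_off {D K : Set 𝔼} (hD : IsOpen D) (hK : IsClosed K) (hKD : K ⊆ D)
    {g : 𝔼 → ℝ} (hg : ContDiffOn ℝ 1 g D) (h0 : ∀ x, x ∉ K → g x = 0) : ContDiff ℝ 1 g := by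
  rw [contDiff_iff_contDiffAt]
  intro x
  by_cases hx : x ∈ K
  · exact hg.contDiffAt (hD.mem_nhds (hKD hx))
  · have : g =ᶠ[𝓝 x] fun _ => 0 := by
      filter_upwards [hK.isOpen_compl.mem_nhds hx] with y hy using h0 y hy
    exact contDiffAt_const.congr_of_eventuallyEq this

lemma continuous_of_zero_off {X : Type*} [TopologicalSpace X] {D K : Set X} (hD : IsOpen D)
    (hK : IsClosed K) (hKD : K ⊆ D)
    {g : X → ℝ} (hg : ContinuousOn g D) (h0 : ∀ x, x ∉ K → g x = 0) : Continuous g := by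
  rw [continuous_iff_continuousAt]
  intro x
  by_cases hx : x ∈ K
  · exact hg.continuousAt (hD.mem_nhds (hKD hx))
  · have : g =ᶠ[𝓝 x] fun _ => 0 := by
      filter_upwards [hK.isOpen_compl.mem_nhds hx] with y hy using h0 y hy
    exact continuousAt_const.congr this.symm

lemma tsupport_subset_of_zero_off {X : Type*} [TopologicalSpace X] {K : Set X} (hK : IsClosed K)
    {g : X → ℝ} (h0 : ∀ x, x ∉ K → g x = 0) : tsupport g ⊆ K :=
  closure_minimal (fun x hx => by by_contra h; exact hx (h0 x h)) hK

lemma ContDiffOn.continuousOn_gradient {D : Set 𝔼} (hD : IsOpen D) {u : 𝔼 → ℝ}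
    (hu : ContDiffOn ℝ 1 u D) : ContinuousOn (gradient u) D :=
  (InnerProductSpace.toDual ℝ 𝔼).symm.continuous.comp_continuousOn
    (hu.continuousOn_fderiv_of_isOpen hD le_rfl)

lemma ContDiff.continuous_gradient {u : 𝔼 → ℝ} (hu : ContDiff ℝ 1 u) :
    Continuous (gradient u) :=
  (InnerProductSpace.toDual ℝ 𝔼).symm.continuous.comp (hu.continuous_fderiv one_ne_zero)

/-- The square of the positive part. -/
lemma hasDerivAt_posPart_sq (s : ℝ) :
    HasDerivAt (fun s : ℝ => (max s 0) ^ 2) (2 * max s 0) s := by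
  rcases lt_trichotomy s 0 with h | h | h
  · have : (fun s : ℝ => (max s 0) ^ 2) =ᶠ[𝓝 s] fun _ => 0 := by
      filter_upwards [gt_mem_nhds h] with y hy
      rw [max_eq_right hy.le]; simp
    rw [max_eq_right h.le, mul_zero]
    exact (hasDerivAt_const s 0).congr_of_eventuallyEq this
  · subst h
    rw [hasDerivAt_iff_isLittleO_nhds_zero]
    simp only [zero_add, max_self, mul_zero, smul_zero, sub_zero, ne_eq, OfNat.ofNat_ne_zero,
      not_false_eq_true, zero_pow]
    rw [Asymptotics.isLittleO_iff]
    intro c hc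
    filter_upwards [Metric.ball_mem_nhds (0 : ℝ) hc] with y hy
    have hy' : |y| < c := by simpa using hy
    have h1 : max y 0 ≤ |y| := max_le (le_abs_self y) (abs_nonneg y)
    have h2 : 0 ≤ max y 0 := le_max_right _ _
    simp only [Real.norm_eq_abs]
    rw [abs_of_nonneg (by positivity)]
    nlinarith [abs_nonneg y]
  · have : (fun s : ℝ => (max s 0) ^ 2) =ᶠ[𝓝 s] fun s => s ^ 2 := by
      filter_upwards [lt_mem_nhds h] with y hy
      rw [max_eq_left hy.le]
    rw [max_eq_left h.le]
    simpa using (hasDerivAt_pow 2 s).congr_of_eventuallyEq this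

lemma contDiff_posPart_sq : ContDiff ℝ 1 (fun s : ℝ => (max s 0) ^ 2) := by
  rw [contDiff_one_iff_deriv]
  refine ⟨fun s => (hasDerivAt_posPart_sq s).differentiableAt, ?_⟩
  have : deriv (fun s : ℝ => (max s 0) ^ 2) = fun s => 2 * max s 0 :=
    funext fun s => (hasDerivAt_posPart_sq s).deriv
  rw [this]
  fun_prop

lemma norm_pow_smul_monotone (k : ℕ) (a b : 𝔼) :
    0 ≤ ‖a‖ ^ k * ⟪a - b, a⟫_ℝ - ‖b‖ ^ k * ⟪a - b, b⟫_ℝ ∧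
    (‖a‖ ^ k * ⟪a - b, a⟫_ℝ - ‖b‖ ^ k * ⟪a - b, b⟫_ℝ = 0 → a = b) := by
  have e : ‖a‖ ^ k * ⟪a - b, a⟫_ℝ - ‖b‖ ^ k * ⟪a - b, b⟫_ℝ =
      (‖a‖ ^ k - ‖b‖ ^ k) * (‖a‖ ^ 2 - ‖b‖ ^ 2) / 2 + (‖a‖ ^ k + ‖b‖ ^ k) * ‖a - b‖ ^ 2 / 2 := by
    rw [@norm_sub_sq_real, inner_sub_left, inner_sub_left, real_inner_self_eq_norm_sq,
      real_inner_self_eq_norm_sq, real_inner_comm b a]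
    ring
  have h1 : 0 ≤ (‖a‖ ^ k - ‖b‖ ^ k) * (‖a‖ ^ 2 - ‖b‖ ^ 2) := by
    rcases le_total ‖a‖ ‖b‖ with h | h
    · exact mul_nonneg_of_nonpos_of_nonpos (sub_nonpos.2 (pow_le_pow_left₀ (norm_nonneg _) h _))
        (sub_nonpos.2 (pow_le_pow_left₀ (norm_nonneg _) h _))
    · exact mul_nonneg (sub_nonneg.2 (pow_le_pow_left₀ (norm_nonneg _) h _))
        (sub_nonneg.2 (pow_le_pow_left₀ (norm_nonneg _) h _))
  have h2 : 0 ≤ (‖a‖ ^ k + ‖b‖ ^ k) * ‖a - b‖ ^ 2 := by positivity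
  rw [e]
  refine ⟨by positivity, fun h => ?_⟩
  have h3 : (‖a‖ ^ k + ‖b‖ ^ k) * ‖a - b‖ ^ 2 = 0 := by linarith
  rcases mul_eq_zero.1 h3 with h4 | h4
  · have ha : ‖a‖ ^ k = 0 := by
      have := pow_nonneg (norm_nonneg a) k
      have := pow_nonneg (norm_nonneg b) k
      linarith
    have hb : ‖b‖ ^ k = 0 := by linarith
    rw [norm_eq_zero.1 (eq_zero_of_pow_eq_zero ha), norm_eq_zero.1 (eq_zero_of_pow_eq_zero hb)]
  · exact sub_eq_zero.1 (norm_eq_zero.1 (eq_zero_of_pow_eq_zero h4))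

/-- Comparison principle for the `n`-Laplacian on a relatively compact open set. -/
theorem nLaplace_comparison (hn : 2 ≤ n) {D K' : Set 𝔼} (hD : IsOpen D) (hK' : IsCompact K')
    (hDK : D ⊆ K') {u h : 𝔼 → ℝ} (hu : ContDiffOn ℝ 1 u D) (hh : ContDiffOn ℝ 1 h D)
    (huc : ContinuousOn u K') (hhc : ContinuousOn h K')
    (hw : ∀ φ : 𝔼 → ℝ, ContDiff ℝ 1 φ → HasCompactSupport φ → tsupport φ ⊆ D → (∀ x, 0 ≤ φ x) →
      nPairing u φ ≤ nPairing h φ)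
    (hb : ∀ x ∈ K', x ∉ D → u x ≤ h x) : ∀ x ∈ D, u x ≤ h x := by
  intro x0 hx0
  by_contra! hlt
  set ε := (u x0 - h x0) / 2 with hε
  have hεpos : 0 < ε := by rw [hε]; linarith
  set K : Set 𝔼 := {x ∈ K' | ε ≤ u x - h x} with hKdef
  have hKc : IsCompact K := by
    have := (huc.sub hhc).preimage_isClosed_of_isClosed hK'.isClosed (isClosed_Ici (a := ε))
    exact hK'.of_isClosed_subset this (fun x hx => hx.1)
  have hKD : K ⊆ D := by
    intro x hx
    by_contra hxD
    have := hb x hx.1 hxD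
    have := hx.2
    linarith
  classical
  set ψ : 𝔼 → ℝ := fun x => if x ∈ D then (max (u x - h x - ε) 0) ^ 2 else 0 with hψ
  have hψ0 : ∀ x, x ∉ K → ψ x = 0 := by
    intro x hx
    simp only [hψ]
    split_ifs with hxD
    · have : u x - h x - ε ≤ 0 := by
        by_contra! hc
        exact hx ⟨hDK hxD, by linarith⟩
      rw [max_eq_right this]; simp
    · rfl
  have hψnn : ∀ x, 0 ≤ ψ x := by
    intro x; simp only [hψ]; split_ifs <;> positivity
  have hψD : ContDiffOn ℝ 1 ψ D := by
    have : ContDiffOn ℝ 1 (fun x => (max (u x - h x - ε) 0) ^ 2) D :=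
      contDiff_posPart_sq.comp_contDiffOn ((hu.sub hh).sub contDiffOn_const)
    exact this.congr (fun x hx => by simp [hψ, hx])
  have hψC : ContDiff ℝ 1 ψ := contDiff_of_zero_off hD hKc.isClosed hKD hψD hψ0
  have hts : tsupport ψ ⊆ K := tsupport_subset_of_zero_off hKc.isClosed hψ0
  have hcs : HasCompactSupport ψ := hKc.of_isClosed_subset (isClosed_tsupport _) hts
  have hfd : ∀ x ∈ D, ∀ ξ, fderiv ℝ ψ x ξ =
      2 * max (u x - h x - ε) 0 * ⟪gradient u x - gradient h x, ξ⟫_ℝ := by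
    intro x hx ξ
    have hux := (hu.differentiableOn one_ne_zero).differentiableAt (hD.mem_nhds hx)
    have hhx := (hh.differentiableOn one_ne_zero).differentiableAt (hD.mem_nhds hx)
    have h1 : HasFDerivAt (fun x => (max (u x - h x - ε) 0) ^ 2)
        ((2 * max (u x - h x - ε) 0) • (fderiv ℝ u x - fderiv ℝ h x)) x :=
      (hasDerivAt_posPart_sq _).comp_hasFDerivAt x
        ((hux.hasFDerivAt.sub hhx.hasFDerivAt).sub_const ε)
    have h2 : ψ =ᶠ[𝓝 x] (fun x => (max (u x - h x - ε) 0) ^ 2) := by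
      filter_upwards [hD.mem_nhds hx] with y hy
      simp [hψ, hy]
    rw [(h1.congr_of_eventuallyEq h2).fderiv]
    simp [inner_sub_left, inner_gradient_left]
  have hfd0 : ∀ x, x ∉ K → fderiv ℝ ψ x = 0 := fun x hx =>
    image_eq_zero_of_notMem_tsupport (fun h => hx (hts (tsupport_fderiv_subset ℝ h)))
  have hcont : ∀ w : 𝔼 → ℝ, ContDiffOn ℝ 1 w D →
      Continuous (fun x => ‖gradient w x‖ ^ (n - 2) * fderiv ℝ ψ x (gradient w x)) := by
    intro w hw
    refine continuous_of_zero_off hD hKc.isClosed hKD ?_ (fun x hx => by simp [hfd0 x hx])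
    have hg := hw.continuousOn_gradient hD
    exact (hg.norm.pow _).mul ((hψC.continuous_fderiv one_ne_zero).continuousOn.clm_apply hg)
  have hint : ∀ w : 𝔼 → ℝ, ContDiffOn ℝ 1 w D →
      Integrable (fun x => ‖gradient w x‖ ^ (n - 2) * fderiv ℝ ψ x (gradient w x)) := by
    intro w hw
    refine (hcont w hw).integrable_of_hasCompactSupport ?_
    exact HasCompactSupport.intro hKc (fun x hx => by simp [hfd0 x hx])
  set I : 𝔼 → ℝ := fun x => ‖gradient u x‖ ^ (n - 2) * fderiv ℝ ψ x (gradient u x) -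
    ‖gradient h x‖ ^ (n - 2) * fderiv ℝ ψ x (gradient h x) with hI
  have hIle : ∫ x, I x ≤ 0 := by
    rw [hI, integral_sub (hint u hu) (hint h hh)]
    have := hw ψ hψC hcs (hts.trans hKD) hψnn
    unfold nPairing at this
    linarith
  have hID : ∀ x ∈ D, I x = 2 * max (u x - h x - ε) 0 *
      (‖gradient u x‖ ^ (n - 2) * ⟪gradient u x - gradient h x, gradient u x⟫_ℝ -
      ‖gradient h x‖ ^ (n - 2) * ⟪gradient u x - gradient h x, gradient h x⟫_ℝ) := by
    intro x hx
    simp only [hI, hfd x hx]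
    ring
  have hInn : ∀ x, 0 ≤ I x := by
    intro x
    by_cases hx : x ∈ K
    · rw [hID x (hKD hx)]
      exact mul_nonneg (by positivity) (norm_pow_smul_monotone _ _ _).1
    · simp [hI, hfd0 x hx]
  have hIc : Continuous I := (hcont u hu).sub (hcont h hh)
  have hI0 : I = 0 := by
    have h1 : ∫ x, I x = 0 := le_antisymm hIle (integral_nonneg hInn)
    rw [integral_eq_zero_iff_of_nonneg hInn ((hint u hu).sub (hint h hh))] at h1
    exact (hIc.ae_eq_iff_eq volume continuous_const).1 h1
  have hfdz : ∀ x, fderiv ℝ ψ x = 0 := by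
    intro x
    by_cases hx : x ∈ K
    · ext ξ
      rw [hfd x (hKD hx)]
      have h1 := hID x (hKD hx)
      rw [hI0] at h1
      rcases mul_eq_zero.1 h1.symm with h2 | h2
      · rw [h2]; simp
      · rw [(norm_pow_smul_monotone _ _ _).2 h2]; simp
    · exact hfd0 x hx
  have : Nonempty (Fin n) := ⟨⟨0, by omega⟩⟩
  have : NoncompactSpace 𝔼 := NormedSpace.noncompactSpace ℝ 𝔼
  obtain ⟨z, hz⟩ := (Set.ne_univ_iff_exists_notMem K).1 hKc.ne_univ
  have h1 := is_const_of_fderiv_eq_zero (hψC.differentiable one_ne_zero) hfdz x0 z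
  rw [hψ0 z hz] at h1
  simp only [hψ, hx0, if_true] at h1
  have h2 : max (u x0 - h x0 - ε) 0 = 0 := eq_zero_of_pow_eq_zero h1
  have h3 := le_max_left (u x0 - h x0 - ε) 0
  rw [h2] at h3
  rw [hε] at h3
  linarith

end NLaplace

section LogEnergy

variable {n : ℕ}

local notation "𝔼" => EuclideanSpace ℝ (Fin n)

/-- The norm of the gradient of `log (w + 1)`, for nonnegative `w`. -/
noncomputable def logSlope (w : 𝔼 → ℝ) (x : 𝔼) : ℝ := ‖gradient w x‖ / (max (w x) 0 + 1)

lemma continuous_logSlope {w : 𝔼 → ℝ} (hw : ContDiff ℝ 1 w) : Continuous (logSlope w) := by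
  unfold logSlope
  refine hw.continuous_gradient.norm.div (by have := hw.continuous; fun_prop) (fun x => ?_)
  have := le_max_right (w x) 0
  positivity

lemma logSlope_nonneg (w : 𝔼 → ℝ) (x : 𝔼) : 0 ≤ logSlope w x := by
  unfold logSlope
  have := le_max_right (w x) 0
  positivity

lemma volume_real_ball (x : 𝔼) {r : ℝ} (hr : 0 < r) :
    volume.real (ball x r) = r ^ n * volume.real (ball (0 : 𝔼) 1) := by
  unfold Measure.real
  rw [Measure.addHaar_ball_of_pos _ _ hr, ENNReal.toReal_mul, ENNReal.toReal_ofReal (by positivity)]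
  simp

lemma young_absorb (m : ℕ) {a d : ℝ} (ha : 0 ≤ a) (hd : 0 ≤ d) :
    (m + 2 : ℝ) * a ^ (m + 1) * d - (m + 1) * a ^ (m + 2) ≤
      - (1 / 2) * a ^ (m + 2) + (2 * (m + 2) : ℝ) ^ (m + 2) * d ^ (m + 2) := by
  have hm : (0 : ℝ) ≤ m := m.cast_nonneg
  rcases le_total (2 * (m + 2) * d) a with h | h
  · have h1 : a ^ (m + 1) * (2 * (m + 2) * d) ≤ a ^ (m + 1) * a :=
      mul_le_mul_of_nonneg_left h (by positivity)
    have h2 : 0 ≤ (2 * (m + 2) : ℝ) ^ (m + 2) * d ^ (m + 2) := by positivity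
    have h3 : 0 ≤ a ^ (m + 2) := by positivity
    have h4 : 0 ≤ m * a ^ (m + 2) := by positivity
    have h5 : a ^ (m + 2) = a ^ (m + 1) * a := pow_succ _ _
    nlinarith
  · have h1 : a ^ (m + 1) ≤ (2 * (m + 2) * d) ^ (m + 1) := pow_le_pow_left₀ ha h _
    have h2 : a ^ (m + 1) * (2 * (m + 2) * d) ≤ (2 * (m + 2) * d) ^ (m + 1) * (2 * (m + 2) * d) :=
      mul_le_mul_of_nonneg_right h1 (by positivity)
    have h3 : (2 * (m + 2) : ℝ) ^ (m + 2) * d ^ (m + 2) =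
        (2 * (m + 2) * d) ^ (m + 1) * (2 * (m + 2) * d) := by
      rw [← mul_pow, pow_succ]
    have h4 : 0 ≤ m * a ^ (m + 2) := by positivity
    have h5 : 0 ≤ a ^ (m + 2) := by positivity
    have h6 : 0 ≤ a ^ (m + 1) * ((m + 2) * d) := by positivity
    rw [h3]
    nlinarith

lemma exists_cutoff : ∃ C : ℝ, 0 ≤ C ∧ ∀ (x₀ : 𝔼) (ρ : ℝ), 0 < ρ → ∃ η : 𝔼 → ℝ,
    ContDiff ℝ 1 η ∧ (∀ x, 0 ≤ η x) ∧ (∀ x, η x ≤ 1) ∧ (∀ x ∈ ball x₀ (ρ / 2), η x = 1) ∧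
    (∀ x, x ∉ closedBall x₀ (3 * ρ / 4) → η x = 0) ∧ ∀ x, ‖fderiv ℝ η x‖ ≤ C / ρ := by
  let β : ContDiffBump (0 : 𝔼) := ⟨1 / 2, 3 / 4, by norm_num, by norm_num⟩
  have hβ : ContDiff ℝ 1 β := β.contDiff
  obtain ⟨C, hC⟩ := (β.hasCompactSupport.fderiv (𝕜 := ℝ)).exists_bound_of_continuous
    (hβ.continuous_fderiv one_ne_zero)
  refine ⟨C, (norm_nonneg _).trans (hC 0), fun x₀ ρ hρ => ⟨fun x => β (ρ⁻¹ • (x - x₀)), ?_,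
    fun x => β.nonneg, fun x => β.le_one, fun x hx => ?_, fun x hx => ?_, fun x => ?_⟩⟩
  · exact hβ.comp (by fun_prop)
  · apply β.one_of_mem_closedBall
    rw [mem_ball, dist_eq_norm] at hx
    rw [mem_closedBall, dist_zero_right, norm_smul, norm_inv, Real.norm_of_nonneg hρ.le]
    change ρ⁻¹ * _ ≤ 1 / 2
    rw [inv_mul_le_iff₀ hρ]
    linarith
  · apply β.zero_of_le_dist
    rw [mem_closedBall, dist_eq_norm, not_le] at hx
    rw [dist_zero_right, norm_smul, norm_inv, Real.norm_of_nonneg hρ.le]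
    change 3 / 4 ≤ _
    rw [le_inv_mul_iff₀ hρ]
    linarith
  · have h1 : HasFDerivAt (fun x => ρ⁻¹ • (x - x₀)) (ρ⁻¹ • ContinuousLinearMap.id ℝ 𝔼) x :=
      ((hasFDerivAt_id x).sub_const x₀).const_smul ρ⁻¹
    have h2 := ((hβ.differentiable one_ne_zero) (ρ⁻¹ • (x - x₀))).hasFDerivAt.comp x h1
    have h3 : fderiv ℝ (fun x => β (ρ⁻¹ • (x - x₀))) x =
        ρ⁻¹ • fderiv ℝ β (ρ⁻¹ • (x - x₀)) := by
      rw [show (fun x => β (ρ⁻¹ • (x - x₀))) = β ∘ (fun x => ρ⁻¹ • (x - x₀)) from rfl, h2.fderiv]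
      ext; simp
    rw [h3, norm_smul, norm_inv, Real.norm_of_nonneg hρ.le, div_eq_inv_mul]
    exact mul_le_mul_of_nonneg_left (hC _) (by positivity)

lemma log_caccioppoli_pointwise (m : ℕ) {η s g d e : ℝ} (hη : 0 ≤ η) (hs : 1 ≤ s)
    (hg : 0 ≤ g) (hd : 0 ≤ d) (he : e ≤ d * g) :
    g ^ m * ((m + 2) * η ^ (m + 1) * e * (s ^ (m + 1))⁻¹ +
      η ^ (m + 2) * (-((m + 1) * s ^ m) / (s ^ (m + 1)) ^ 2) * g ^ 2) ≤
    - (1 / 2) * (η * (g / s)) ^ (m + 2) + (2 * (m + 2) : ℝ) ^ (m + 2) * d ^ (m + 2) := by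
  have hs0 : 0 < s := by linarith
  refine le_trans ?_ (young_absorb m (mul_nonneg hη (div_nonneg hg hs0.le)) hd)
  have h1 : g ^ m * ((m + 2) * η ^ (m + 1) * e * (s ^ (m + 1))⁻¹) ≤
      g ^ m * ((m + 2) * η ^ (m + 1) * (d * g) * (s ^ (m + 1))⁻¹) := by gcongr
  have h2 : g ^ m * ((m + 2) * η ^ (m + 1) * (d * g) * (s ^ (m + 1))⁻¹) =
      (m + 2) * (η * (g / s)) ^ (m + 1) * d := by
    rw [mul_pow, div_pow]; field_simp; ring
  have h3 : g ^ m * (η ^ (m + 2) * (-((m + 1) * s ^ m) / (s ^ (m + 1)) ^ 2) * g ^ 2) =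
      - ((m + 1) * (η * (g / s)) ^ (m + 2)) := by
    rw [mul_pow, div_pow]; field_simp; ring
  rw [mul_add, h3]
  linarith

/-- The logarithm of a nonnegative solution has scale-invariantly bounded `n`-energy. -/
theorem log_caccioppoli (hn : 2 ≤ n) {Λ : ℝ} (hΛ : 0 ≤ Λ) : ∃ E : ℝ, 0 ≤ E ∧
    ∀ (w f : 𝔼 → ℝ) (x₀ : 𝔼) (ρ : ℝ), 0 < ρ → ContDiff ℝ 1 w → Continuous f →
      WeakSol (ball x₀ ρ) w f → (∀ x ∈ ball x₀ ρ, 0 ≤ w x) →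
      (∀ x ∈ ball x₀ ρ, |f x| ≤ Λ / ρ ^ n) →
      ∫ x in ball x₀ (ρ / 2), logSlope w x ^ n ≤ E := by
  obtain ⟨C, hC0, hC⟩ := exists_cutoff (n := n)
  obtain ⟨m, rfl⟩ : ∃ m, n = m + 2 := ⟨n - 2, by omega⟩
  set B : ℝ := (2 * (m + 2) : ℝ) ^ (m + 2) with hB
  refine ⟨2 * ((B * C ^ (m + 2) + Λ) * volume.real (ball (0 : EuclideanSpace ℝ (Fin (m + 2))) 1)),
    by positivity, ?_⟩
  intro w f x₀ ρ hρ hw hf hsol hw0 hfΛ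
  obtain ⟨η, hη, hη0, hη1, hηone, hηz, hηd⟩ := hC x₀ ρ hρ
  set K := closedBall x₀ (3 * ρ / 4) with hK
  set D := ball x₀ ρ with hD
  have hKD : K ⊆ D := closedBall_subset_ball (by linarith)
  have hKc : IsCompact K := isCompact_closedBall _ _
  set φ : EuclideanSpace ℝ (Fin (m + 2)) → ℝ :=
    fun x => η x ^ (m + 2) * ((w x + 1) ^ (m + 1))⁻¹ with hφ
  have hφ0 : ∀ x, x ∉ K → φ x = 0 := fun x hx => by simp [hφ, hηz x hx]
  have hφC : ContDiff ℝ 1 φ := by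
    refine contDiff_of_zero_off isOpen_ball hKc.isClosed hKD ?_ hφ0
    refine (hη.pow _).contDiffOn.mul (ContDiffOn.inv ?_ ?_)
    · exact ((hw.add contDiff_const).pow _).contDiffOn
    · intro x hx
      have := hw0 x hx
      positivity
  have hts : tsupport φ ⊆ K := tsupport_subset_of_zero_off hKc.isClosed hφ0
  have hcs : HasCompactSupport φ := HasCompactSupport.intro hKc hφ0
  have hφnn : ∀ x ∈ D, 0 ≤ φ x := fun x hx => by
    have := hw0 x hx
    have := hη0 x
    simp only [hφ]; positivity
  have hφ1 : ∀ x ∈ D, φ x ≤ 1 := fun x hx => by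
    have h1 := hw0 x hx
    have h2 : η x ^ (m + 2) ≤ 1 := pow_le_one₀ (hη0 x) (hη1 x)
    have h3 : ((w x + 1) ^ (m + 1))⁻¹ ≤ 1 := inv_le_one_of_one_le₀ (one_le_pow₀ (by linarith))
    have h4 : 0 ≤ ((w x + 1) ^ (m + 1))⁻¹ := by positivity
    exact mul_le_one₀ h2 h4 h3
  have hfd : ∀ x ∈ D, ∀ ξ, fderiv ℝ φ x ξ =
      (m + 2) * η x ^ (m + 1) * fderiv ℝ η x ξ * ((w x + 1) ^ (m + 1))⁻¹ +
      η x ^ (m + 2) * (-((m + 1) * (w x + 1) ^ m) / ((w x + 1) ^ (m + 1)) ^ 2) *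
        fderiv ℝ w x ξ := by
    intro x hx ξ
    have h0 := hw0 x hx
    have h1 : HasFDerivAt (fun x => η x ^ (m + 2))
        ((((m + 2 : ℕ) : ℝ) * η x ^ (m + 1)) • fderiv ℝ η x) x :=
      (hasDerivAt_pow (m + 2) (η x)).comp_hasFDerivAt x
        (hη.differentiable one_ne_zero x).hasFDerivAt
    have h2 : HasDerivAt (fun s : ℝ => (s ^ (m + 1))⁻¹)
        (-(((m + 1 : ℕ) : ℝ) * (w x + 1) ^ m) / ((w x + 1) ^ (m + 1)) ^ 2) (w x + 1) :=
      (hasDerivAt_pow (m + 1) (w x + 1)).inv (by positivity)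
    have h3 : HasFDerivAt (fun x => ((w x + 1) ^ (m + 1))⁻¹)
        ((-(((m + 1 : ℕ) : ℝ) * (w x + 1) ^ m) / ((w x + 1) ^ (m + 1)) ^ 2) • fderiv ℝ w x) x :=
      HasDerivAt.comp_hasFDerivAt (h₂ := fun s : ℝ => (s ^ (m + 1))⁻¹)
        (f := fun x => w x + 1)
        x h2 ((hw.differentiable one_ne_zero x).hasFDerivAt.add_const 1)
    have h4 : HasFDerivAt φ _ x := h1.mul h3
    rw [h4.fderiv]
    simp
    ring
  have hfd0 : ∀ x, x ∉ K → fderiv ℝ φ x = 0 := fun x hx =>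
    image_eq_zero_of_notMem_tsupport (fun h => hx (hts (tsupport_fderiv_subset ℝ h)))
  have hηd0 : ∀ x, x ∉ K → fderiv ℝ η x = 0 := fun x hx =>
    image_eq_zero_of_notMem_tsupport
      (fun h => hx (tsupport_subset_of_zero_off hKc.isClosed hηz (tsupport_fderiv_subset ℝ h)))
  have hgc := hw.continuous_gradient
  have hpt : ∀ x, ‖gradient w x‖ ^ m * fderiv ℝ φ x (gradient w x) ≤
      - (1 / 2) * (η x * logSlope w x) ^ (m + 2) + B * ‖fderiv ℝ η x‖ ^ (m + 2) := by
    intro x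
    by_cases hx : x ∈ K
    · rw [hfd x (hKD hx)]
      have h0 := hw0 x (hKD hx)
      have h1 : fderiv ℝ w x (gradient w x) = ‖gradient w x‖ ^ 2 := by
        rw [← inner_gradient_left, real_inner_self_eq_norm_sq]
      rw [h1]
      unfold logSlope
      rw [max_eq_left h0]
      exact log_caccioppoli_pointwise m (hη0 x) (by linarith) (norm_nonneg _) (norm_nonneg _)
        ((le_abs_self _).trans ((fderiv ℝ η x).le_opNorm _))
    · rw [hfd0 x hx, hηd0 x hx, hηz x hx]
      simp
  have hI1 : Integrable (fun x => ‖gradient w x‖ ^ m * fderiv ℝ φ x (gradient w x)) := by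
    refine Continuous.integrable_of_hasCompactSupport ?_
      (HasCompactSupport.intro hKc (fun x hx => by simp [hfd0 x hx]))
    exact (hgc.norm.pow _).mul ((hφC.continuous_fderiv one_ne_zero).clm_apply hgc)
  have hI2 : Integrable (fun x => (η x * logSlope w x) ^ (m + 2)) := by
    refine Continuous.integrable_of_hasCompactSupport
      ((hη.continuous.mul (continuous_logSlope hw)).pow _)
      (HasCompactSupport.intro hKc (fun x hx => by simp [hηz x hx]))
  have hI3 : Integrable (fun x => B * ‖fderiv ℝ η x‖ ^ (m + 2)) := by
    refine Continuous.integrable_of_hasCompactSupport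
      (((hη.continuous_fderiv one_ne_zero).norm.pow _).const_mul B)
      (HasCompactSupport.intro hKc (fun x hx => by simp [hηd0 x hx]))
  have hI4 : Integrable (fun x => f x * φ x) :=
    (hf.mul hφC.continuous).integrable_of_hasCompactSupport
      (HasCompactSupport.intro hKc (fun x hx => by simp [hφ0 x hx]))
  have hweak := hsol φ hφC hcs (hts.trans hKD)
  unfold nPairing at hweak
  simp only [Nat.add_sub_cancel] at hweak
  have hmain : (1 / 2) * ∫ x, (η x * logSlope w x) ^ (m + 2) ≤
      ∫ x, (B * ‖fderiv ℝ η x‖ ^ (m + 2) - f x * φ x) := by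
    rw [integral_sub hI3 hI4, ← hweak, ← integral_sub hI3 hI1, ← integral_const_mul]
    refine integral_mono (hI2.const_mul _) (hI3.sub hI1) (fun x => ?_)
    have := hpt x
    simp only
    linarith
  have hbd : ∫ x, (B * ‖fderiv ℝ η x‖ ^ (m + 2) - f x * φ x) ≤
      ∫ x in D, (B * C ^ (m + 2) + Λ) / ρ ^ (m + 2) := by
    rw [← integral_indicator measurableSet_ball]
    refine integral_mono (hI3.sub hI4) ?_ (fun x => ?_)
    · exact (integrable_indicator_iff measurableSet_ball).2
        (integrableOn_const (measure_ball_lt_top.ne))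
    · by_cases hx : x ∈ D
      · rw [indicator_of_mem hx]
        have h1 : ‖fderiv ℝ η x‖ ^ (m + 2) ≤ (C / ρ) ^ (m + 2) :=
          pow_le_pow_left₀ (norm_nonneg _) (hηd x) _
        have h2 : -(f x * φ x) ≤ Λ / ρ ^ (m + 2) := by
          calc -(f x * φ x) ≤ |f x * φ x| := neg_le_abs _
            _ = |f x| * φ x := by rw [abs_mul, abs_of_nonneg (hφnn x hx)]
            _ ≤ |f x| * 1 := mul_le_mul_of_nonneg_left (hφ1 x hx) (abs_nonneg _)
            _ ≤ _ := by rw [mul_one]; exact hfΛ x hx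
        have h3 : B * ‖fderiv ℝ η x‖ ^ (m + 2) ≤ B * (C / ρ) ^ (m + 2) :=
          mul_le_mul_of_nonneg_left h1 (by positivity)
        rw [div_pow] at h3
        rw [add_div, mul_div_assoc]
        linarith
      · rw [indicator_of_notMem hx]
        have hx' : x ∉ K := fun h => hx (hKD h)
        simp [hηd0 x hx', hφ0 x hx']
  rw [setIntegral_const, volume_real_ball _ hρ, smul_eq_mul] at hbd
  have hρn : ρ ^ (m + 2) ≠ 0 := by positivity
  have hfin : ∫ x in ball x₀ (ρ / 2), logSlope w x ^ (m + 2) ≤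
      ∫ x, (η x * logSlope w x) ^ (m + 2) := by
    calc ∫ x in ball x₀ (ρ / 2), logSlope w x ^ (m + 2)
        = ∫ x in ball x₀ (ρ / 2), (η x * logSlope w x) ^ (m + 2) :=
          setIntegral_congr_fun measurableSet_ball (fun x hx => by simp [hηone x hx])
      _ ≤ _ := setIntegral_le_integral hI2 (ae_of_all _ fun x =>
          pow_nonneg (mul_nonneg (hη0 x) (logSlope_nonneg w x)) _)
  have : ρ ^ (m + 2) * volume.real (ball (0 : EuclideanSpace ℝ (Fin (m + 2))) 1) *
      ((B * C ^ (m + 2) + Λ) / ρ ^ (m + 2)) =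
      (B * C ^ (m + 2) + Λ) * volume.real (ball (0 : EuclideanSpace ℝ (Fin (m + 2))) 1) := by
    field_simp
  rw [this] at hbd
  linarith

end LogEnergy

section Morrey

variable {m : ℕ}

local notation "𝔽" => (Fin m → ℝ)

lemma le_inv_add_pow (m : ℕ) {a k : ℝ} (ha : 0 ≤ a) (hk : 0 < k) :
    a ≤ k⁻¹ + k ^ m * a ^ (m + 1) := by
  rcases le_total a k⁻¹ with h | h
  · have : 0 ≤ k ^ m * a ^ (m + 1) := by positivity
    linarith
  · have h1 : 1 ≤ k * a := by
      rw [inv_le_iff_one_le_mul₀ hk] at h; linarith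
    have h2 : a * 1 ≤ a * (k * a) ^ m := mul_le_mul_of_nonneg_left (one_le_pow₀ h1) ha
    have h3 : a * (k * a) ^ m = k ^ m * a ^ (m + 1) := by rw [mul_pow]; ring
    have : 0 < k⁻¹ := by positivity
    linarith

lemma setIntegral_contraction_le {Q : Set 𝔽} (hQ : IsCompact Q) (hQc : Convex ℝ Q) {H : 𝔽 → ℝ}
    (hH : Continuous H) (hH0 : ∀ y, 0 ≤ H y) {x : 𝔽} (hx : x ∈ Q) {t : ℝ} (ht : 0 < t)
    (ht1 : t ≤ 1) :
    ∫ z in Q, H (x + t • (z - x)) ≤ (t ^ m)⁻¹ * ∫ z in Q, H z := by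
  have hi : Integrable (Q.indicator H) :=
    (integrable_indicator_iff hQ.measurableSet).2 (hH.continuousOn.integrableOn_compact hQ)
  have hi0 : ∀ y, 0 ≤ Q.indicator H y := fun y => indicator_nonneg (fun z _ => hH0 z) y
  have hmem : ∀ z ∈ Q, x + t • (z - x) ∈ Q := fun z hz =>
    hQc.add_smul_sub_mem hx hz ⟨ht.le, ht1⟩
  have he : ∀ z, x + t • (z - x) = (x - t • x) + t • z := fun z => by
    rw [smul_sub]; abel
  have hi2 : Integrable (fun z => Q.indicator H (x + t • (z - x))) := by
    simp_rw [he]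
    exact (hi.comp_add_left (x - t • x)).comp_smul ht.ne'
  calc ∫ z in Q, H (x + t • (z - x)) = ∫ z in Q, Q.indicator H (x + t • (z - x)) :=
        setIntegral_congr_fun hQ.measurableSet
          (fun z hz => (indicator_of_mem (hmem z hz) H).symm)
    _ ≤ ∫ z, Q.indicator H (x + t • (z - x)) :=
        setIntegral_le_integral hi2 (ae_of_all _ fun z => hi0 _)
    _ = (t ^ m)⁻¹ * ∫ z in Q, H z := by
        simp_rw [he]
        rw [Measure.integral_comp_smul volume (fun z => Q.indicator H (x - t • x + z)),
          integral_add_left_eq_self, integral_indicator hQ.measurableSet]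
        rw [abs_of_nonneg (by positivity)]
        simp

lemma setIntegral_segment_le {b : ℝ} (hb : 0 < b) {G : 𝔽 → ℝ} (hG : Continuous G)
    (hG0 : ∀ y, 0 ≤ G y) {x : 𝔽} (hx : x ∈ closedBall (0 : 𝔽) b) :
    ∫ z in closedBall (0 : 𝔽) b, ∫ t in (0 : ℝ)..1, G (x + t • (z - x)) ≤
      (m + 1) * (volume.real (closedBall (0 : 𝔽) b) / b +
        b ^ m * ∫ z in closedBall (0 : 𝔽) b, G z ^ (m + 1)) := by
  set Q := closedBall (0 : 𝔽) b with hQ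
  have hQc : IsCompact Q := isCompact_closedBall _ _
  set J := ∫ z in Q, G z ^ (m + 1) with hJ
  set S := volume.real Q / b + b ^ m * J with hS
  have hexp : (-1 : ℝ) < -(m / (m + 1) : ℝ) := by
    rw [neg_lt_neg_iff, div_lt_one (by positivity)]; linarith
  have hkey : ∀ t ∈ Ioc (0 : ℝ) 1, ∫ z in Q, G (x + t • (z - x)) ≤
      S * t ^ (-(m / (m + 1) : ℝ)) := by
    intro t ht
    have ht0 := ht.1
    set p : ℝ := m / (m + 1) with hp
    set k : ℝ := b * t ^ p with hk
    have hkpos : 0 < k := by positivity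
    have hcont : Continuous (fun z : 𝔽 => x + t • (z - x)) := by fun_prop
    have h1 : ∫ z in Q, G (x + t • (z - x)) ≤
        ∫ z in Q, (k⁻¹ + k ^ m * G (x + t • (z - x)) ^ (m + 1)) := by
      refine setIntegral_mono ((hG.comp hcont).continuousOn.integrableOn_compact hQc)
        (Continuous.continuousOn ?_ |>.integrableOn_compact hQc)
        (fun z => le_inv_add_pow m (hG0 _) hkpos)
      have := hG.comp hcont
      simp only [Function.comp_def] at this
      fun_prop
    have h2 : ∫ z in Q, (k⁻¹ + k ^ m * G (x + t • (z - x)) ^ (m + 1)) =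
        volume.real Q * k⁻¹ + k ^ m * ∫ z in Q, G (x + t • (z - x)) ^ (m + 1) := by
      rw [integral_add, setIntegral_const, integral_const_mul, smul_eq_mul]
      · exact integrableOn_const hQc.measure_lt_top.ne
      · refine (Continuous.continuousOn ?_).integrableOn_compact hQc
        have := hG.comp hcont
        simp only [Function.comp_def] at this
        fun_prop
    have h3 := setIntegral_contraction_le hQc (convex_closedBall _ _) (hG.pow (m + 1))
      (fun y => pow_nonneg (hG0 y) _) hx ht0 ht.2
    have h4 : k ^ m * (t ^ m)⁻¹ = b ^ m * t ^ (-p) := by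
      rw [hk, mul_pow, ← Real.rpow_natCast (t ^ p), ← Real.rpow_mul ht0.le, mul_assoc,
        ← Real.rpow_natCast t m, ← Real.rpow_neg ht0.le, ← Real.rpow_add ht0]
      congr 2
      rw [hp]; field_simp; ring
    have h5 : k⁻¹ = b⁻¹ * t ^ (-p) := by
      rw [hk, mul_inv, Real.rpow_neg ht0.le]
    calc ∫ z in Q, G (x + t • (z - x)) ≤ _ := h1
      _ = _ := h2
      _ ≤ volume.real Q * k⁻¹ + k ^ m * ((t ^ m)⁻¹ * J) := by
          gcongr
          exact h3
      _ = S * t ^ (-p) := by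
          rw [← mul_assoc, h4, h5, hS]; field_simp
  have hcont2 : Continuous (fun q : 𝔽 × ℝ => G (x + q.2 • (q.1 - x))) := by
    refine hG.comp ?_
    fun_prop
  have hswap : ∫ z in Q, ∫ t in (0 : ℝ)..1, G (x + t • (z - x)) =
      ∫ t in (0 : ℝ)..1, ∫ z in Q, G (x + t • (z - x)) := by
    simp_rw [intervalIntegral.integral_of_le zero_le_one]
    refine integral_integral_swap ?_
    rw [Measure.prod_restrict]
    refine IntegrableOn.mono_set ?_ (Set.prod_mono_right Ioc_subset_Icc_self)
    exact hcont2.continuousOn.integrableOn_compact (hQc.prod isCompact_Icc)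
  rw [hswap]
  have hint1 : IntervalIntegrable (fun t : ℝ => ∫ z in Q, G (x + t • (z - x))) volume 0 1 := by
    refine Continuous.intervalIntegrable ?_ _ _
    refine continuous_parametric_integral_of_continuous
      (f := fun (t : ℝ) (z : 𝔽) => G (x + t • (z - x))) ?_ hQc
    exact hcont2.comp continuous_swap
  have hint2 : IntervalIntegrable (fun t : ℝ => S * t ^ (-(m / (m + 1) : ℝ))) volume 0 1 :=
    (intervalIntegral.intervalIntegrable_rpow' hexp).const_mul S
  calc ∫ t in (0 : ℝ)..1, ∫ z in Q, G (x + t • (z - x)) ≤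
      ∫ t in (0 : ℝ)..1, S * t ^ (-(m / (m + 1) : ℝ)) := by
        rw [intervalIntegral.integral_of_le zero_le_one,
          intervalIntegral.integral_of_le zero_le_one]
        exact setIntegral_mono_on hint1.1 hint2.1 measurableSet_Ioc hkey
    _ = (m + 1) * S := by
        rw [intervalIntegral.integral_const_mul, integral_rpow (Or.inl hexp)]
        have h1 : (0 : ℝ) < -(m / (m + 1)) + 1 := by linarith
        rw [Real.zero_rpow h1.ne', Real.one_rpow]
        have : (-(m / (m + 1)) + 1 : ℝ) = 1 / (m + 1) := by field_simp; ring
        rw [this]; simp; ring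

/-- A Morrey-type oscillation bound on the cube `[-b, b]^m`, with exponent `m + 1`. -/
theorem morrey_cube {b : ℝ} (hb : 0 < b) {A : ℝ} (hA : 0 ≤ A) {g G : 𝔽 → ℝ} (hG : Continuous G)
    (hG0 : ∀ y, 0 ≤ G y)
    (hg : ∀ x ∈ closedBall (0 : 𝔽) b, ∀ z ∈ closedBall (0 : 𝔽) b,
      |g x - g z| ≤ A * ∫ t in (0 : ℝ)..1, G (x + t • (z - x)))
    {x y : 𝔽} (hx : x ∈ closedBall (0 : 𝔽) b) (hy : y ∈ closedBall (0 : 𝔽) b) :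
    |g x - g y| ≤ 2 * A * (m + 1) *
      (b⁻¹ + ∫ z in closedBall (0 : 𝔽) b, G z ^ (m + 1)) := by
  have h1 := setIntegral_segment_le hb hG hG0 hx
  have h2 := setIntegral_segment_le hb hG hG0 hy
  set Q := closedBall (0 : 𝔽) b with hQ
  have hQc : IsCompact Q := isCompact_closedBall _ _
  set J := ∫ z in Q, G z ^ (m + 1) with hJ
  have hJ0 : 0 ≤ J := integral_nonneg fun z => pow_nonneg (hG0 z) _
  have hvol : volume.real Q = (2 * b) ^ m := by
    rw [hQ, Measure.real, Real.volume_pi_closedBall _ hb.le, ENNReal.toReal_ofReal (by positivity)]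
    simp
  have hcts : ∀ x : 𝔽, Continuous (fun z => ∫ t in (0 : ℝ)..1, G (x + t • (z - x))) := by
    intro x
    refine intervalIntegral.continuous_parametric_intervalIntegral_of_continuous'
      (f := fun (z : 𝔽) (t : ℝ) => G (x + t • (z - x))) ?_ 0 1
    refine hG.comp ?_
    fun_prop
  have h3 : volume.real Q * |g x - g y| ≤
      A * ((∫ z in Q, ∫ t in (0 : ℝ)..1, G (x + t • (z - x))) +
        ∫ z in Q, ∫ t in (0 : ℝ)..1, G (y + t • (z - y))) := by
    rw [← integral_add ((hcts x).continuousOn.integrableOn_compact hQc)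
      ((hcts y).continuousOn.integrableOn_compact hQc), ← integral_const_mul, ← smul_eq_mul,
      ← setIntegral_const]
    refine setIntegral_mono_on (integrableOn_const hQc.measure_lt_top.ne) ?_
      hQc.measurableSet (fun z hz => ?_)
    · exact ((((hcts x).add (hcts y)).const_smul A).continuousOn.integrableOn_compact hQc)
    · have e1 := hg x hx z hz
      have e2 := hg y hy z hz
      have : |g x - g y| ≤ |g x - g z| + |g z - g y| := abs_sub_le _ _ _
      rw [abs_sub_comm (g z)] at this
      rw [mul_add]
      linarith
  have h4 : volume.real Q * |g x - g y| ≤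
      A * (2 * ((m + 1) * (volume.real Q / b + b ^ m * J))) :=
    h3.trans (mul_le_mul_of_nonneg_left (by linarith) hA)
  have h5 : b ^ m * J ≤ volume.real Q * J := by
    rw [hvol]
    refine mul_le_mul_of_nonneg_right (pow_le_pow_left₀ hb.le (by linarith) _) hJ0
  have hQpos : 0 < volume.real Q := by rw [hvol]; positivity
  have h6 : volume.real Q * |g x - g y| ≤ volume.real Q * (2 * A * (m + 1) * (b⁻¹ + J)) := by
    refine h4.trans ?_
    have : A * (2 * ((m + 1) * (volume.real Q / b + b ^ m * J))) ≤
        A * (2 * ((m + 1) * (volume.real Q / b + volume.real Q * J))) := by gcongr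
    refine this.trans (le_of_eq ?_)
    field_simp
  exact le_of_mul_le_mul_left h6 hQpos

end Morrey

section Segment

variable {n : ℕ}

local notation "𝔼" => EuclideanSpace ℝ (Fin n)

lemma norm_le_card_mul {v : 𝔼} {M : ℝ} (hM : 0 ≤ M) (hv : ∀ j, |v j| ≤ M) : ‖v‖ ≤ n * M := by
  rw [EuclideanSpace.norm_eq]
  refine Real.sqrt_le_iff.2 ⟨by positivity, ?_⟩
  have h1 : ∑ i, ‖v i‖ ^ 2 ≤ ∑ _i : Fin n, M ^ 2 :=
    Finset.sum_le_sum fun i _ => pow_le_pow_left₀ (norm_nonneg _) (hv i) 2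
  refine h1.trans ?_
  simp only [Finset.sum_const, Finset.card_univ, Fintype.card_fin, nsmul_eq_mul, mul_pow]
  refine mul_le_mul_of_nonneg_right ?_ (by positivity)
  exact_mod_cast Nat.le_self_pow two_ne_zero n

lemma abs_log_sub_log_le {w : 𝔼 → ℝ} (hw : ContDiff ℝ 1 w) {B : Set 𝔼} (hB : Convex ℝ B)
    (hw0 : ∀ x ∈ B, 0 ≤ w x) {p q : 𝔼} (hp : p ∈ B) (hq : q ∈ B) :
    |log (w p + 1) - log (w q + 1)| ≤
      ‖q - p‖ * ∫ t in (0 : ℝ)..1, logSlope w (p + t • (q - p)) := by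
  set l : ℝ → 𝔼 := fun t => p + t • (q - p) with hl
  have hlc : Continuous l := by fun_prop
  set d : ℝ → ℝ := fun t => fderiv ℝ w (l t) (q - p) / (max (w (l t)) 0 + 1) with hd
  have hden : ∀ t, 0 < max (w (l t)) 0 + 1 := fun t => by
    have := le_max_right (w (l t)) 0
    linarith
  have hdc : Continuous d := by
    refine Continuous.div ?_ ?_ (fun t => (hden t).ne')
    · exact ((hw.continuous_fderiv one_ne_zero).comp hlc).clm_apply continuous_const
    · exact ((hw.continuous.comp hlc).max continuous_const).add continuous_const
  have hmem : ∀ t ∈ uIcc (0 : ℝ) 1, l t ∈ B := by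
    intro t ht
    rw [uIcc_of_le zero_le_one] at ht
    exact hB.add_smul_sub_mem hp hq ht
  have hder : ∀ t ∈ uIcc (0 : ℝ) 1, HasDerivAt (fun t => log (w (l t) + 1)) (d t) t := by
    intro t ht
    have h0 := hw0 _ (hmem t ht)
    have h1 : HasDerivAt l (q - p) t := by
      have := ((hasDerivAt_id t).smul_const (q - p)).const_add p
      rw [one_smul] at this
      exact this
    have h2 := ((hw.differentiable one_ne_zero (l t)).hasFDerivAt.comp_hasDerivAt t h1)
    have h3 := (h2.add_const 1).log (by simp only [Function.comp]; linarith)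
    simp only [hd, max_eq_left h0]
    exact h3
  have hF := intervalIntegral.integral_eq_sub_of_hasDerivAt hder (hdc.intervalIntegrable _ _)
  have e0 : l 0 = p := by simp [hl]
  have e1 : l 1 = q := by simp [hl]
  rw [e0, e1] at hF
  rw [abs_sub_comm, ← hF, ← intervalIntegral.integral_const_mul]
  refine (intervalIntegral.abs_integral_le_integral_abs zero_le_one).trans ?_
  refine intervalIntegral.integral_mono_on zero_le_one (hdc.abs.intervalIntegrable _ _)
    ((((continuous_logSlope hw).comp hlc).const_mul _).intervalIntegrable _ _) ?_
  intro t _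
  have h4 : |fderiv ℝ w (l t) (q - p)| ≤ ‖gradient w (l t)‖ * ‖q - p‖ := by
    rw [← inner_gradient_left]; exact abs_real_inner_le_norm _ _
  simp only [hd, logSlope, abs_div, abs_of_pos (hden t)]
  rw [mul_div_assoc', mul_comm ‖q - p‖]
  exact div_le_div_of_nonneg_right h4 (hden t).le

end Segment

section Faces

variable {m : ℕ}

local notation "𝔼" => EuclideanSpace ℝ (Fin (m + 1))
local notation "𝔽" => (Fin m → ℝ)

/-- Parametrisation of the hyperplane `x i = x₀ i + c`. -/
noncomputable def facePt (x₀ : 𝔼) (i : Fin (m + 1)) (c : ℝ) (y : 𝔽) : 𝔼 :=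
  x₀ + WithLp.toLp 2 (Fin.insertNth i c y : Fin (m + 1) → ℝ)

lemma facePt_self (x₀ : 𝔼) (i : Fin (m + 1)) (c : ℝ) (y : 𝔽) : facePt x₀ i c y i = x₀ i + c := by
  simp [facePt]

lemma facePt_succAbove (x₀ : 𝔼) (i : Fin (m + 1)) (c : ℝ) (y : 𝔽) (j : Fin m) :
    facePt x₀ i c y (i.succAbove j) = x₀ (i.succAbove j) + y j := by
  simp [facePt]

lemma facePt_segment (x₀ : 𝔼) (i : Fin (m + 1)) (c : ℝ) (y z : 𝔽) (t : ℝ) :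
    facePt x₀ i c (y + t • (z - y)) =
      facePt x₀ i c y + t • (facePt x₀ i c z - facePt x₀ i c y) := by
  ext j
  rcases Fin.eq_self_or_eq_succAbove i j with rfl | ⟨j, rfl⟩
  · simp [facePt_self]
  · simp [facePt_succAbove]; ring

lemma facePt_coord (x₀ p : 𝔼) (i : Fin (m + 1)) :
    facePt x₀ i (p i - x₀ i) (fun j => p (i.succAbove j) - x₀ (i.succAbove j)) = p := by
  ext j
  rcases Fin.eq_self_or_eq_succAbove i j with rfl | ⟨j, rfl⟩
  · simp [facePt_self]
  · simp [facePt_succAbove]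

lemma facePt_abs_le {x₀ : 𝔼} {i : Fin (m + 1)} {c b : ℝ} {y : 𝔽} (hc : |c| ≤ b)
    (hy : y ∈ closedBall (0 : 𝔽) b) (j : Fin (m + 1)) : |(facePt x₀ i c y - x₀) j| ≤ b := by
  have hb : 0 ≤ b := (abs_nonneg c).trans hc
  rcases Fin.eq_self_or_eq_succAbove i j with rfl | ⟨j, rfl⟩
  · simpa [facePt_self] using hc
  · rw [mem_closedBall_zero_iff, pi_norm_le_iff_of_nonneg hb] at hy
    simpa [facePt_succAbove] using hy j

lemma continuous_facePt (x₀ : 𝔼) (i : Fin (m + 1)) :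
    Continuous (fun q : ℝ × 𝔽 => facePt x₀ i q.1 q.2) := by
  unfold facePt
  have : Continuous (fun q : ℝ × 𝔽 => (Fin.insertNth i q.1 q.2 : Fin (m + 1) → ℝ)) := by
    refine continuous_pi fun j => ?_
    rcases Fin.eq_self_or_eq_succAbove i j with rfl | ⟨j, rfl⟩
    · simpa using continuous_fst
    · simp; fun_prop
  exact continuous_const.add ((PiLp.continuous_toLp 2 _).comp this)

lemma integral_faces_le (x₀ : 𝔼) (i : Fin (m + 1)) {b r : ℝ} (hr : (m + 1 : ℝ) * b < r)
    {H : 𝔼 → ℝ} (hH : Continuous H) (hH0 : ∀ x, 0 ≤ H x) :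
    ∫ c in Icc (-b) b, ∫ y in closedBall (0 : 𝔽) b, H (facePt x₀ i c y) ≤
      ∫ x in ball x₀ r, H x := by
  let e := (MeasurableEquiv.piFinSuccAbove (fun _ : Fin (m + 1) => ℝ) i).symm.trans
    ((MeasurableEquiv.toLp 2 (Fin (m + 1) → ℝ)).trans (MeasurableEquiv.addLeft x₀))
  have he : ∀ q : ℝ × 𝔽, e q = facePt x₀ i q.1 q.2 := fun q => rfl
  have hmp : MeasurePreserving e (volume.prod volume) volume := by
    have h1 := (volume_preserving_piFinSuccAbove (fun _ : Fin (m + 1) => ℝ) i).symm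
    have h2 := EuclideanSpace.volume_preserving_symm_measurableEquiv_toLp (Fin (m + 1))
    have h3 : MeasurePreserving (MeasurableEquiv.toLp 2 (Fin (m + 1) → ℝ)) volume volume :=
      h2.symm
    have h4 : MeasurePreserving (MeasurableEquiv.addLeft x₀) (volume : Measure 𝔼) volume :=
      measurePreserving_add_left volume x₀
    exact (h1.trans h3).trans h4
  set Q := closedBall (0 : 𝔽) b
  have hQc : IsCompact Q := isCompact_closedBall _ _
  have hcont : Continuous (fun q : ℝ × 𝔽 => H (facePt x₀ i q.1 q.2)) :=
    hH.comp (continuous_facePt x₀ i)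
  have h1 : ∫ c in Icc (-b) b, ∫ y in Q, H (facePt x₀ i c y) =
      ∫ q in Icc (-b) b ×ˢ Q, H (e q) ∂(volume.prod volume) := by
    rw [setIntegral_prod]
    · rfl
    · exact hcont.continuousOn.integrableOn_compact (isCompact_Icc.prod hQc)
  rw [h1, ← hmp.setIntegral_preimage_emb e.measurableEmbedding]
  have hsub : Icc (-b) b ×ˢ Q ⊆ e ⁻¹' (ball x₀ r) := by
    rintro ⟨c, y⟩ ⟨hc, hy⟩
    have hc' : |c| ≤ b := abs_le.2 hc
    rw [mem_preimage, he, mem_ball, dist_eq_norm]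
    refine lt_of_le_of_lt (norm_le_card_mul ((abs_nonneg c).trans hc')
      (facePt_abs_le hc' hy)) ?_
    exact_mod_cast hr
  refine setIntegral_mono_set ?_ (ae_of_all _ fun q => hH0 _) hsub.eventuallyLE
  have := (hmp.integrableOn_comp_preimage e.measurableEmbedding (f := H) (s := ball x₀ r)).2 
    ((hH.continuousOn.integrableOn_compact (isCompact_closedBall x₀ r)).mono_set
      ball_subset_closedBall)
  exact this

lemma face_osc {w : 𝔼 → ℝ} (hw : ContDiff ℝ 1 w) {x₀ : 𝔼} {r b : ℝ} (hb : 0 < b)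
    (hr : (m + 1 : ℝ) * b < r) (hw0 : ∀ x ∈ ball x₀ r, 0 ≤ w x) {i : Fin (m + 1)} {c : ℝ}
    (hc : |c| ≤ b) {p q : 𝔼} (hp : ∀ j, |p j - x₀ j| ≤ b) (hq : ∀ j, |q j - x₀ j| ≤ b)
    (hpi : p i - x₀ i = c) (hqi : q i - x₀ i = c) :
    |log (w p + 1) - log (w q + 1)| ≤ 4 * (m + 1) ^ 2 *
      (1 + b * ∫ y in closedBall (0 : 𝔽) b, logSlope w (facePt x₀ i c y) ^ (m + 1)) := by
  have hmem : ∀ y ∈ closedBall (0 : 𝔽) b, facePt x₀ i c y ∈ ball x₀ r := by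
    intro y hy
    rw [mem_ball, dist_eq_norm]
    refine lt_of_le_of_lt (norm_le_card_mul hb.le (facePt_abs_le hc hy)) ?_
    exact_mod_cast hr
  have hG : Continuous (fun y : 𝔽 => logSlope w (facePt x₀ i c y)) :=
    (continuous_logSlope hw).comp ((continuous_facePt x₀ i).comp (Continuous.prodMk_right c))
  have key := morrey_cube (A := 2 * ((m + 1) * b)) (g := fun y => log (w (facePt x₀ i c y) + 1))
    hb (by positivity) hG (fun y => logSlope_nonneg _ _) ?_
    (x := fun j => p (i.succAbove j) - x₀ (i.succAbove j))
    (y := fun j => q (i.succAbove j) - x₀ (i.succAbove j)) ?_ ?_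
  · simp only at key
    have e1 := facePt_coord x₀ p i
    have e2 := facePt_coord x₀ q i
    rw [hpi] at e1
    rw [hqi] at e2
    rw [e1, e2] at key
    refine key.trans (le_of_eq ?_)
    field_simp
    ring
  · intro y hy z hz
    refine (abs_log_sub_log_le hw (convex_ball x₀ r) hw0 (hmem y hy) (hmem z hz)).trans ?_
    simp_rw [facePt_segment]
    refine mul_le_mul_of_nonneg_right ?_
      (intervalIntegral.integral_nonneg zero_le_one fun t _ => logSlope_nonneg _ _)
    have : facePt x₀ i c z - facePt x₀ i c y =
        (facePt x₀ i c z - x₀) - (facePt x₀ i c y - x₀) := by abel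
    rw [this]
    refine (norm_sub_le _ _).trans ?_
    have h1 := norm_le_card_mul hb.le (facePt_abs_le (x₀ := x₀) (i := i) hc hy)
    have h2 := norm_le_card_mul hb.le (facePt_abs_le (x₀ := x₀) (i := i) hc hz)
    push_cast at h1 h2
    linarith
  · rw [mem_closedBall_zero_iff, pi_norm_le_iff_of_nonneg hb.le]
    exact fun j => hp _
  · rw [mem_closedBall_zero_iff, pi_norm_le_iff_of_nonneg hb.le]
    exact fun j => hq _

lemma exists_good_cube {x₀ : 𝔼} {b r : ℝ} (hb : 0 < b) (hr : (m + 1 : ℝ) * b < r)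
    {H : 𝔼 → ℝ} (hH : Continuous H) (hH0 : ∀ x, 0 ≤ H x) {E : ℝ}
    (hE : ∫ x in ball x₀ r, H x ≤ E) :
    ∃ s ∈ Icc (b / 2) b, ∀ (i : Fin (m + 1)) (c : ℝ), |c| = s →
      b * ∫ y in closedBall (0 : 𝔽) b, H (facePt x₀ i c y) ≤ 2 * (m + 1) * E + 1 := by
  set J : Fin (m + 1) → ℝ → ℝ := fun i c => ∫ y in closedBall (0 : 𝔽) b, H (facePt x₀ i c y)
    with hJ
  have hJc : ∀ i, Continuous (J i) := fun i =>
    continuous_parametric_integral_of_continuous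
      (f := fun (c : ℝ) (y : 𝔽) => H (facePt x₀ i c y)) (hH.comp (continuous_facePt x₀ i))
      (isCompact_closedBall _ _)
  have hJ0 : ∀ i c, 0 ≤ J i c := fun i c => integral_nonneg fun y => hH0 _
  have hJE : ∀ i, ∫ c in (-b)..b, J i c ≤ E := by
    intro i
    rw [intervalIntegral.integral_of_le (by linarith), ← integral_Icc_eq_integral_Ioc]
    exact (integral_faces_le x₀ i hr hH hH0).trans hE
  have hJi : ∀ i x y, IntervalIntegrable (J i) volume x y := fun i x y =>
    (hJc i).intervalIntegrable _ _
  have hJs : ∀ i, ∫ c in (b / 2)..b, (J i c + J i (-c)) ≤ E := by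
    intro i
    have hneg : IntervalIntegrable (fun c => J i (-c)) volume (b / 2) b :=
      ((hJc i).comp continuous_neg).intervalIntegrable _ _
    rw [intervalIntegral.integral_add (hJi i _ _) hneg,
      intervalIntegral.integral_comp_neg (fun c => J i c)]
    have e1 := intervalIntegral.integral_add_adjacent_intervals (hJi i (-b) (-(b / 2)))
      (hJi i (-(b / 2)) b)
    have e2 := intervalIntegral.integral_add_adjacent_intervals (hJi i (-(b / 2)) (b / 2))
      (hJi i (b / 2) b)
    have e3 : 0 ≤ ∫ c in (-(b / 2))..(b / 2), J i c :=
      intervalIntegral.integral_nonneg (by linarith) fun c _ => hJ0 i c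
    have := hJE i
    linarith
  by_contra! hcon
  have hlow : ∀ s ∈ Icc (b / 2) b, (2 * (m + 1) * E + 1) / b ≤ ∑ i, (J i s + J i (-s)) := by
    intro s hs
    obtain ⟨i, c, hc, hlt⟩ := hcon s hs
    have h1 : (2 * (m + 1) * E + 1) / b ≤ J i c := by
      rw [div_le_iff₀ hb, mul_comm (J i c)]; exact hlt.le
    have h2 : J i c ≤ J i s + J i (-s) := by
      rcases (abs_eq (by linarith [hs.1])).1 hc with rfl | rfl
      · linarith [hJ0 i (-c)]
      · linarith [hJ0 i s]
    refine h1.trans (h2.trans ?_)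
    exact Finset.single_le_sum (f := fun i => J i s + J i (-s))
      (fun i _ => add_nonneg (hJ0 i _) (hJ0 i _)) (Finset.mem_univ i)
  have hsc : ∀ i, Continuous (fun c => J i c + J i (-c)) := fun i =>
    (hJc i).add ((hJc i).comp continuous_neg)
  have h3 : ∫ _s in (b / 2)..b, (2 * (m + 1) * E + 1) / b ≤
      ∫ s in (b / 2)..b, ∑ i, (J i s + J i (-s)) :=
    intervalIntegral.integral_mono_on (by linarith) (by simp)
      ((continuous_finsetSum _ fun i _ => hsc i).intervalIntegrable _ _) hlow
  rw [intervalIntegral.integral_const, intervalIntegral.integral_finsetSum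
    (fun i _ => (hsc i).intervalIntegrable _ _)] at h3
  have h4 : ∑ i : Fin (m + 1), ∫ s in (b / 2)..b, (J i s + J i (-s)) ≤ ∑ _i : Fin (m + 1), E :=
    Finset.sum_le_sum fun i _ => hJs i
  simp only [Finset.sum_const, Finset.card_univ, Fintype.card_fin, nsmul_eq_mul,
    smul_eq_mul] at h3 h4
  have h5 : (b - b / 2) * ((2 * (m + 1) * E + 1) / b) = (m + 1) * E + 1 / 2 := by
    field_simp; ring
  push_cast at h4
  linarith

end Faces

section CubeBoundary

variable {n : ℕ}

local notation "𝔼" => EuclideanSpace ℝ (Fin n)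

/-- Oscillation of `log (w + 1)` on the boundary of a well chosen cube, for a nonnegative
solution `w`. -/
theorem cube_boundary_osc (hn : 2 ≤ n) {Λ : ℝ} (hΛ : 0 ≤ Λ) : ∃ C : ℝ, 0 ≤ C ∧
    ∀ (w f : 𝔼 → ℝ) (x₀ : 𝔼) (ρ : ℝ), 0 < ρ → ContDiff ℝ 1 w → Continuous f →
      WeakSol (ball x₀ ρ) w f → (∀ x ∈ ball x₀ ρ, 0 ≤ w x) →
      (∀ x ∈ ball x₀ ρ, |f x| ≤ Λ / ρ ^ n) →
      ∃ s ∈ Icc (ρ / (8 * n)) (ρ / (4 * n)), ∀ p q : 𝔼,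
        (∀ j, |p j - x₀ j| ≤ s) → (∃ i, |p i - x₀ i| = s) →
        (∀ j, |q j - x₀ j| ≤ s) → (∃ i, |q i - x₀ i| = s) →
        |log (w p + 1) - log (w q + 1)| ≤ C := by
  obtain ⟨E, hE0, hE⟩ := log_caccioppoli hn hΛ
  obtain ⟨m, rfl⟩ : ∃ m, n = m + 1 := ⟨n - 1, by omega⟩
  set c₀ : ℝ := 4 * (m + 1) ^ 2 * (1 + (2 * (m + 1) * E + 1)) with hc₀
  have hc₀0 : 0 ≤ c₀ := by positivity
  refine ⟨3 * c₀, by positivity, ?_⟩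
  intro w f x₀ ρ hρ hw hf hsol hw0 hfΛ
  have hEw := hE w f x₀ ρ hρ hw hf hsol hw0 hfΛ
  have hn0 : (0 : ℝ) < (m + 1 : ℕ) := by positivity
  set b : ℝ := ρ / (4 * (m + 1 : ℕ)) with hb
  have hbpos : 0 < b := by positivity
  have hr : (m + 1 : ℝ) * b < ρ / 2 := by
    rw [hb]; push_cast
    have : (m + 1 : ℝ) * (ρ / (4 * (m + 1))) = ρ / 4 := by field_simp
    rw [this]; linarith
  obtain ⟨s, hs, hsE⟩ := exists_good_cube hbpos hr ((continuous_logSlope hw).pow (m + 1))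
    (fun x => pow_nonneg (logSlope_nonneg _ _) _) hEw
  have hs0 : 0 < s := lt_of_lt_of_le (by positivity) hs.1
  have hface : ∀ p q : EuclideanSpace ℝ (Fin (m + 1)), (∀ j, |p j - x₀ j| ≤ s) →
      (∀ j, |q j - x₀ j| ≤ s) → ∀ i, |p i - x₀ i| = s → q i - x₀ i = p i - x₀ i →
      |log (w p + 1) - log (w q + 1)| ≤ c₀ := by
    intro p q hp hq i hpi hqi
    refine (face_osc hw hbpos hr (fun x hx => hw0 x (ball_subset_ball (by linarith) hx))
      (hpi.le.trans hs.2) (fun j => (hp j).trans hs.2) (fun j => (hq j).trans hs.2)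
      rfl hqi).trans ?_
    rw [hc₀]
    have := hsE i _ hpi
    gcongr
    exact this
  refine ⟨s, ⟨?_, hs.2⟩, ?_⟩
  · refine le_trans (le_of_eq ?_) hs.1
    rw [hb]; field_simp; norm_num
  rintro p q hp ⟨i, hpi⟩ hq ⟨k, hqk⟩
  have hedge : ∀ (i k : Fin (m + 1)) (σ τ : ℝ), i ≠ k → |σ| = s → |τ| = s →
      ∃ r : EuclideanSpace ℝ (Fin (m + 1)), (∀ j, |r j - x₀ j| ≤ s) ∧ r i - x₀ i = σ ∧
        r k - x₀ k = τ := by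
    intro i k σ τ hik hσ hτ
    refine ⟨x₀ + WithLp.toLp 2 (fun j => if j = i then σ else if j = k then τ else 0), ?_, ?_, ?_⟩
    · intro j
      simp only [PiLp.add_apply, add_sub_cancel_left]
      split_ifs
      · exact hσ.le
      · exact hτ.le
      · simpa using hs0.le
    · simp
    · simp [hik.symm]
  have tri : ∀ a b c : EuclideanSpace ℝ (Fin (m + 1)), |log (w a + 1) - log (w c + 1)| ≤
      |log (w a + 1) - log (w b + 1)| + |log (w b + 1) - log (w c + 1)| :=
    fun a b c => abs_sub_le _ _ _
  by_cases hik : i = k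
  · subst hik
    have : Nontrivial (Fin (m + 1)) := Fin.nontrivial_iff_two_le.2 hn
    obtain ⟨l, hl⟩ := exists_ne i
    obtain ⟨r, hr0, hr1, hr2⟩ := hedge i l (p i - x₀ i) s hl.symm hpi (abs_of_pos hs0)
    obtain ⟨r', hr0', hr1', hr2'⟩ := hedge i l (q i - x₀ i) s hl.symm hqk (abs_of_pos hs0)
    have h1 := hface p r hp hr0 i hpi hr1
    have h2 := hface r r' hr0 hr0' l (by rw [hr2, abs_of_pos hs0]) (by rw [hr2, hr2'])
    have h3 := hface r' q hr0' hq i (by rw [hr1', hqk]) hr1'.symm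
    linarith [tri p r q, tri r r' q]
  · obtain ⟨r, hr0, hr1, hr2⟩ := hedge i k (p i - x₀ i) (q k - x₀ k) hik hpi hqk
    have h1 := hface p r hp hr0 i hpi hr1
    have h2 := hface r q hr0 hq k (by rw [hr2, hqk]) hr2.symm
    linarith [tri p r q]

end CubeBoundary

section Barrier

variable {n : ℕ}

local notation "𝔼" => EuclideanSpace ℝ (Fin n)

lemma nPairing_const_add (a : ℝ) (u φ : 𝔼 → ℝ) :
    nPairing (fun x => a + u x) φ = nPairing u φ := by
  unfold nPairing gradient
  simp only [fderiv_const_add]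

lemma nPairing_const_sub (a : ℝ) (u φ : 𝔼 → ℝ) :
    nPairing (fun x => a - u x) φ = - nPairing u φ := by
  unfold nPairing gradient
  simp only [fderiv_const_sub, map_neg, norm_neg, mul_neg, integral_neg]

lemma WeakSol.const_add {U : Set 𝔼} {u f : 𝔼 → ℝ} (h : WeakSol U u f) (a : ℝ) :
    WeakSol U (fun x => a + u x) f := fun φ h1 h2 h3 => by
  rw [nPairing_const_add]; exact h φ h1 h2 h3

lemma WeakSol.const_sub {U : Set 𝔼} {u f : 𝔼 → ℝ} (h : WeakSol U u f) (a : ℝ) :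
    WeakSol U (fun x => a - u x) (fun x => - f x) := fun φ h1 h2 h3 => by
  rw [nPairing_const_sub, h φ h1 h2 h3]
  simp only [neg_mul, integral_neg]

lemma integral_fderiv_sub {φ : 𝔼 → ℝ} (hφ : ContDiff ℝ 1 φ) (hc : HasCompactSupport φ) (x₀ : 𝔼) :
    ∫ x, fderiv ℝ φ x (x - x₀) = - (n * ∫ x, φ x) := by
  have hd : ∀ x, fderiv ℝ φ x (x - x₀) =
      ∑ j : Fin n, (x - x₀) j * fderiv ℝ φ x (EuclideanSpace.single j 1) := by
    intro x
    conv_lhs => rw [← (EuclideanSpace.basisFun (Fin n) ℝ).sum_repr (x - x₀)]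
    rw [map_sum]
    refine Finset.sum_congr rfl fun j _ => ?_
    rw [map_smul]
    simp
  have hcf : ∀ v, Continuous (fun x => fderiv ℝ φ x v) := fun v =>
    (hφ.continuous_fderiv one_ne_zero).clm_apply continuous_const
  have hcs : ∀ v, HasCompactSupport (fun x => fderiv ℝ φ x v) := fun v =>
    hc.fderiv_apply ℝ v
  have hproj : ∀ j : Fin n, Continuous (fun x : 𝔼 => (x - x₀) j) := fun j => by fun_prop
  have hI : ∀ j, Integrable (fun x : 𝔼 => (x - x₀) j * fderiv ℝ φ x (EuclideanSpace.single j 1)) :=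
    fun j => ((hproj j).mul (hcf _)).integrable_of_hasCompactSupport (hcs _).mul_left
  have hder : ∀ (j : Fin n) (x : 𝔼),
      HasFDerivAt (fun x : 𝔼 => (x - x₀) j) (EuclideanSpace.proj j : 𝔼 →L[ℝ] ℝ) x := fun j x => by
    have := (EuclideanSpace.proj j : 𝔼 →L[ℝ] ℝ).hasFDerivAt (x := x)
    exact this.sub_const (x₀ j)
  have hj : ∀ j : Fin n, ∫ x, (x - x₀) j * fderiv ℝ φ x (EuclideanSpace.single j 1) =
      - ∫ x, φ x := by
    intro j
    have hfd : ∀ x, fderiv ℝ (fun x : 𝔼 => (x - x₀) j) x (EuclideanSpace.single j 1) = 1 := by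
      intro x; rw [(hder j x).fderiv]; simp
    rw [integral_mul_fderiv_eq_neg_fderiv_mul_of_integrable]
    · simp_rw [hfd, one_mul]
    · simp_rw [hfd, one_mul]
      exact hφ.continuous.integrable_of_hasCompactSupport hc
    · exact hI j
    · exact ((hproj j).mul hφ.continuous).integrable_of_hasCompactSupport hc.mul_left
    · exact fun x _ => (hder j x).differentiableAt
    · exact fun x _ => hφ.differentiable one_ne_zero x
  simp_rw [hd]
  rw [integral_finsetSum _ fun j _ => hI j]
  simp_rw [hj]
  simp

lemma nPairing_power_barrier (hn : 2 ≤ n) {B : ℝ} (hB : 0 ≤ B) (M : ℝ) (x₀ : 𝔼) {φ : 𝔼 → ℝ}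
    (hφ : ContDiff ℝ 1 φ) (hc : HasCompactSupport φ) :
    nPairing (fun x => M - B * ‖x - x₀‖ ^ ((n : ℝ) / (n - 1))) φ =
      n * (B * ((n : ℝ) / (n - 1))) ^ (n - 1) * ∫ x, φ x := by
  obtain ⟨m, rfl⟩ : ∃ m, n = m + 2 := ⟨n - 2, by omega⟩
  set q : ℝ := ((m + 2 : ℕ) : ℝ) / ((m + 2 : ℕ) - 1) with hq
  have hq' : q = (m + 2) / (m + 1) := by rw [hq]; push_cast; ring_nf
  have hq1 : 1 < q := by rw [hq', one_lt_div (by positivity)]; linarith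
  have hder : ∀ x, fderiv ℝ (fun x => M - B * ‖x - x₀‖ ^ q) x =
      - ((B * (q * ‖x - x₀‖ ^ (q - 2))) • innerSL ℝ (x - x₀)) := by
    intro x
    have h1 := (hasFDerivAt_norm_rpow (x - x₀) hq1).comp x ((hasFDerivAt_id x).sub_const x₀)
    have h2 := (h1.const_mul B).const_sub M
    have h3 := h2.fderiv
    refine h3.trans ?_
    ext v
    simp
    ring
  have hgrad : ∀ x, gradient (fun x => M - B * ‖x - x₀‖ ^ q) x =
      - ((B * (q * ‖x - x₀‖ ^ (q - 2))) • (x - x₀)) := by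
    intro x
    refine ext_inner_right ℝ fun v => ?_
    rw [inner_gradient_left, hder]
    simp [inner_smul_left, inner_neg_left, inner_sub_left]
  unfold nPairing
  simp only [show m + 2 - 2 = m by omega, show m + 2 - 1 = m + 1 by omega]
  have hpt : ∀ x, ‖gradient (fun x => M - B * ‖x - x₀‖ ^ q) x‖ ^ m *
      fderiv ℝ φ x (gradient (fun x => M - B * ‖x - x₀‖ ^ q) x) =
      - (B * q) ^ (m + 1) * fderiv ℝ φ x (x - x₀) := by
    intro x
    rw [hgrad, norm_neg, norm_smul, map_neg, map_smul, smul_eq_mul]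
    rcases eq_or_ne x x₀ with rfl | hx
    · simp
    have hr : 0 < ‖x - x₀‖ := norm_pos_iff.2 (sub_ne_zero.2 hx)
    set r := ‖x - x₀‖
    rw [Real.norm_eq_abs, abs_of_nonneg (by positivity)]
    have key : (r ^ (q - 2) * r) ^ m * r ^ (q - 2) = 1 := by
      rw [← Real.rpow_add_one hr.ne', ← Real.rpow_natCast, ← Real.rpow_mul hr.le,
        ← Real.rpow_add hr]
      have : (q - 2 + 1) * m + (q - 2) = 0 := by rw [hq']; field_simp; ring
      rw [this, Real.rpow_zero]
    calc _ = - (B * q) ^ (m + 1) * ((r ^ (q - 2) * r) ^ m * r ^ (q - 2)) *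
          fderiv ℝ φ x (x - x₀) := by ring
      _ = _ := by rw [key, mul_one]
  simp_rw [hpt]
  rw [integral_const_mul, integral_fderiv_sub hφ hc]
  push_cast
  ring

lemma contDiff_power_barrier (hn : 2 ≤ n) (M B : ℝ) (x₀ : 𝔼) :
    ContDiff ℝ 1 (fun x => M - B * ‖x - x₀‖ ^ ((n : ℝ) / (n - 1))) := by
  have h2 : (2 : ℝ) ≤ n := by exact_mod_cast hn
  have hq1 : 1 < (n : ℝ) / (n - 1) := by rw [one_lt_div (by linarith)]; linarith
  exact contDiff_const.sub (contDiff_const.mul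
    ((contDiff_norm_rpow hq1).comp (contDiff_id.sub contDiff_const)))

/-- A one-sided maximum principle with bounded right-hand side. -/
lemma le_add_of_boundary_le (hn : 2 ≤ n) {Λ : ℝ} (hΛ : 0 ≤ Λ) {w f : 𝔼 → ℝ} {x₀ : 𝔼} {ρ : ℝ}
    (hρ : 0 < ρ) (hw : ContDiff ℝ 1 w) (hf : Continuous f) (hsol : WeakSol (ball x₀ ρ) w f)
    (hfΛ : ∀ x ∈ ball x₀ ρ, f x ≤ Λ / ρ ^ n) {D K' : Set 𝔼} (hD : IsOpen D) (hK : IsCompact K')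
    (hDK : D ⊆ K') (hKb : K' ⊆ ball x₀ ρ) {M : ℝ} (hM : ∀ x ∈ K', x ∉ D → w x ≤ M) :
    ∀ x ∈ D, w x ≤ M + (Λ + 1) := by
  have h2 : (2 : ℝ) ≤ n := by exact_mod_cast hn
  set q : ℝ := (n : ℝ) / (n - 1) with hq
  have hq1 : 1 < q := by rw [hq, one_lt_div (by linarith)]; linarith
  have hn1 : n - 1 ≠ 0 := by omega
  set B : ℝ := (Λ + 1) / ρ ^ q with hB
  have hB0 : 0 ≤ B := by positivity
  have hBρ : B * ρ ^ q = Λ + 1 := by rw [hB]; field_simp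
  have hBn : Λ / ρ ^ n ≤ n * (B * q) ^ (n - 1) := by
    have e1 : (ρ ^ q) ^ (n - 1) = ρ ^ n := by
      rw [← Real.rpow_natCast, ← Real.rpow_mul hρ.le, ← Real.rpow_natCast]
      congr 1
      rw [hq, Nat.cast_sub (by omega)]
      have : (n : ℝ) - 1 ≠ 0 := by linarith
      field_simp
      push_cast; ring
    have e2 : (B * q) ^ (n - 1) = ((Λ + 1) * q) ^ (n - 1) / ρ ^ n := by
      rw [← e1, ← div_pow, hB]; congr 1; ring
    rw [e2, mul_div_assoc']
    gcongr
    have h4 : (1 : ℝ) ≤ (Λ + 1) * q := by nlinarith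
    have h5 : (Λ + 1) * q ≤ ((Λ + 1) * q) ^ (n - 1) := le_self_pow₀ h4 hn1
    nlinarith
  have hcmp := nLaplace_comparison hn hD hK hDK (u := w)
    (h := fun x => (M + (Λ + 1)) - B * ‖x - x₀‖ ^ q) hw.contDiffOn
    (contDiff_power_barrier hn _ _ _).contDiffOn hw.continuous.continuousOn
    (contDiff_power_barrier hn _ _ _).continuous.continuousOn ?_ ?_
  · intro x hx
    refine (hcmp x hx).trans ?_
    have : 0 ≤ B * ‖x - x₀‖ ^ q := by positivity
    linarith
  · intro φ hφ hφc hφD hφ0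
    rw [nPairing_power_barrier hn hB0 _ _ hφ hφc, hsol φ hφ hφc (hφD.trans (hDK.trans hKb)),
      ← integral_const_mul]
    refine integral_mono ((hf.mul hφ.continuous).integrable_of_hasCompactSupport hφc.mul_left)
      ((hφ.continuous.integrable_of_hasCompactSupport hφc).const_mul _) fun x => ?_
    by_cases hx : x ∈ tsupport φ
    · exact mul_le_mul_of_nonneg_right ((hfΛ x (hKb (hDK (hφD hx)))).trans hBn) (hφ0 x)
    · simp [image_eq_zero_of_notMem_tsupport hx]
  · intro x hx hxD
    have h3 : ‖x - x₀‖ ^ q ≤ ρ ^ q := by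
      have := hKb hx
      rw [mem_ball, dist_eq_norm] at this
      exact Real.rpow_le_rpow (norm_nonneg _) this.le (by linarith)
    have h4 : B * ‖x - x₀‖ ^ q ≤ Λ + 1 := by
      rw [← hBρ]; exact mul_le_mul_of_nonneg_left h3 hB0
    have := hM x hx hxD
    linarith

/-- Local Harnack inequality (with the additive constant normalised to `1`). -/
theorem local_harnack (hn : 2 ≤ n) {Λ : ℝ} (hΛ : 0 ≤ Λ) : ∃ C : ℝ, 1 ≤ C ∧
    ∀ (w f : 𝔼 → ℝ) (x₀ : 𝔼) (ρ : ℝ), 0 < ρ → ContDiff ℝ 1 w → Continuous f →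
      WeakSol (ball x₀ ρ) w f → (∀ x ∈ ball x₀ ρ, 0 ≤ w x) →
      (∀ x ∈ ball x₀ ρ, |f x| ≤ Λ / ρ ^ n) →
      ∀ y ∈ ball x₀ (ρ / (8 * n)), ∀ z ∈ ball x₀ (ρ / (8 * n)), w y + 1 ≤ C * (w z + 1) := by
  obtain ⟨C₀, hC₀, hosc⟩ := cube_boundary_osc hn hΛ
  have h2 : (2 : ℝ) ≤ n := by exact_mod_cast hn
  set β := Λ + 1 with hβ
  have hexp : 1 ≤ exp C₀ := Real.one_le_exp hC₀
  refine ⟨(exp C₀ + β) * ((1 + β) * exp C₀), ?_, ?_⟩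
  · have h1 : 1 ≤ exp C₀ + β := by linarith
    have h3 : 1 ≤ (1 + β) * exp C₀ := by nlinarith
    nlinarith
  intro w f x₀ ρ hρ hw hf hsol hw0 hfΛ
  obtain ⟨s, hs, hpq⟩ := hosc w f x₀ ρ hρ hw hf hsol hw0 hfΛ
  have hs0 : 0 < s := lt_of_lt_of_le (by positivity) hs.1
  set D : Set 𝔼 := {x | ∀ j, |x j - x₀ j| < s} with hD
  set K' : Set 𝔼 := {x | ∀ j, |x j - x₀ j| ≤ s} with hK'
  have hDo : IsOpen D := by
    rw [hD, ofPred_forall]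
    refine isOpen_iInter_of_finite fun j => isOpen_lt (by fun_prop) continuous_const
  have hKn : ∀ x ∈ K', ‖x - x₀‖ ≤ ρ / 4 := by
    intro x hx
    have h1 := norm_le_card_mul (v := x - x₀) hs0.le hx
    have h3 : (n : ℝ) * s ≤ n * (ρ / (4 * n)) := by
      have := hs.2
      gcongr
    have h4 : (n : ℝ) * (ρ / (4 * n)) = ρ / 4 := by field_simp
    linarith
  have hKb : K' ⊆ ball x₀ ρ := fun x hx => by
    rw [mem_ball, dist_eq_norm]; linarith [hKn x hx]
  have hKc : IsCompact K' := by
    refine (isCompact_closedBall x₀ (ρ / 4)).of_isClosed_subset ?_ fun x hx => by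
      rw [mem_closedBall, dist_eq_norm]; exact hKn x hx
    rw [hK', ofPred_forall]
    exact isClosed_iInter fun j => isClosed_le (by fun_prop) continuous_const
  have hDK : D ⊆ K' := fun x hx j => (hx j).le
  have hbd : ∀ x ∈ K', x ∉ D → ∃ i, |x i - x₀ i| = s := by
    intro x hx hxD
    simp only [hD, mem_ofPred_eq, not_forall, not_lt] at hxD
    obtain ⟨i, hi⟩ := hxD
    exact ⟨i, le_antisymm (hx i) hi⟩
  set p : 𝔼 := x₀ + WithLp.toLp 2 (fun _ => s) with hp
  have hpj : ∀ j, |p j - x₀ j| = s := fun j => by simp [hp, abs_of_pos hs0]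
  have hpK : p ∈ K' := fun j => (hpj j).le
  have hpi : ∃ i, |p i - x₀ i| = s := ⟨⟨0, by omega⟩, hpj _⟩
  set W := w p + 1 with hW
  have hW1 : 1 ≤ W := by linarith [hw0 p (hKb hpK)]
  have hbw : ∀ x ∈ K', x ∉ D → w x + 1 ≤ exp C₀ * W ∧ exp (-C₀) * W ≤ w x + 1 := by
    intro x hx hxD
    have h1 := abs_le.1 (hpq x p hx (hbd x hx hxD) hpK hpi)
    have hx1 : 0 < w x + 1 := by linarith [hw0 x (hKb hx)]
    have hW0 : 0 < W := by linarith
    constructor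
    · rw [← Real.log_le_log_iff hx1 (by positivity), Real.log_mul (by positivity) hW0.ne',
        Real.log_exp]
      linarith
    · rw [← Real.log_le_log_iff (by positivity) hx1, Real.log_mul (by positivity) hW0.ne',
        Real.log_exp]
      linarith
  have hup := le_add_of_boundary_le hn hΛ hρ hw hf hsol (fun x hx => (abs_le.1 (hfΛ x hx)).2)
    hDo hKc hDK hKb (M := exp C₀ * W - 1) (fun x hx hxD => by linarith [(hbw x hx hxD).1])
  have hlo := le_add_of_boundary_le hn hΛ hρ (w := fun x => 0 - w x)
    (f := fun x => - f x) (contDiff_const.sub hw)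
    hf.neg (hsol.const_sub 0) (fun x hx => by linarith [(abs_le.1 (hfΛ x hx)).1])
    hDo hKc hDK hKb (M := 1 - exp (-C₀) * W) (fun x hx hxD => by linarith [(hbw x hx hxD).2])
  have hin : ∀ x ∈ ball x₀ (ρ / (8 * n)), x ∈ D := by
    intro x hx j
    rw [mem_ball, dist_eq_norm] at hx
    have := PiLp.norm_apply_le (x - x₀) j
    simp only [PiLp.sub_apply, Real.norm_eq_abs] at this
    linarith [hs.1]
  intro y hy z hz
  have hy1 := hup y (hin y hy)
  have hz1 := hlo z (hin z hz)
  have hz0 := hw0 z (hKb (hDK (hin z hz)))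
  have h5 : exp (-C₀) * W ≤ (1 + β) * (w z + 1) := by nlinarith
  have h6 : W ≤ (1 + β) * exp C₀ * (w z + 1) := by
    have h7 : W = exp C₀ * (exp (-C₀) * W) := by
      rw [← mul_assoc, ← Real.exp_add]; simp
    rw [h7, mul_comm (1 + β), mul_assoc]
    gcongr
  calc w y + 1 ≤ exp C₀ * W + β := by linarith
    _ ≤ (exp C₀ + β) * W := by nlinarith
    _ ≤ (exp C₀ + β) * ((1 + β) * exp C₀ * (w z + 1)) := by gcongr
    _ = _ := by ring

end Barrier

section Decay

variable {n : ℕ}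

local notation "𝔼" => EuclideanSpace ℝ (Fin n)

/-- Small mass of `exp u` on a ball gives a scale-invariant upper bound at the centre. -/
theorem exp_mul_pow_le_of_small_mass (hn : 2 ≤ n) : ∃ ε : ℝ, 0 < ε ∧
    ∀ (u : 𝔼 → ℝ) (x₀ : 𝔼) (ρ : ℝ), 0 < ρ → ContDiff ℝ 1 u →
      WeakSol (ball x₀ ρ) u (fun x => exp (u x)) → ∫ x in ball x₀ ρ, exp (u x) ≤ ε →
      ρ ^ n * exp (u x₀) ≤ 2 ^ n := by
  obtain ⟨C, hC1, hC⟩ := local_harnack hn (Λ := 2 ^ n) (by positivity)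
  have h2 : (2 : ℝ) ≤ n := by exact_mod_cast hn
  have : Nonempty (Fin n) := ⟨⟨0, by omega⟩⟩
  set ω := volume.real (ball (0 : 𝔼) 1) with hω
  have hω0 : 0 < ω := ENNReal.toReal_pos (measure_ball_pos _ _ one_pos).ne' measure_ball_lt_top.ne
  set C₁ := C * (n * log 2 + 1) with hC₁
  set μ := exp (-C₁) * ((1 / (8 * n)) ^ n * ω) with hμ
  have hμ0 : 0 < μ := by positivity
  refine ⟨μ / 2, by positivity, ?_⟩
  intro u x₀ ρ hρ hu hsol hmass
  by_contra! hlt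
  have hcont : Continuous (fun y => (ρ - ‖y - x₀‖) ^ n * exp (u y)) := by
    have := hu.continuous
    fun_prop
  obtain ⟨y₀, hy₀, hmax⟩ := (isCompact_closedBall x₀ ρ).exists_isMaxOn
    ⟨x₀, mem_closedBall_self hρ.le⟩ hcont.continuousOn
  have hy₀' : ‖y₀ - x₀‖ ≤ ρ := by rwa [mem_closedBall, dist_eq_norm] at hy₀
  set d := ρ - ‖y₀ - x₀‖ with hd
  have hd0 : 0 ≤ d := by linarith
  have hbig : 2 ^ n < d ^ n * exp (u y₀) := by
    have h1 := hmax (mem_closedBall_self hρ.le : x₀ ∈ closedBall x₀ ρ)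
    simp only [mem_ofPred_eq, sub_self, norm_zero, sub_zero] at h1
    linarith
  set l := exp (-(u y₀) / n) with hl
  have hl0 : 0 < l := exp_pos _
  have hln : l ^ n * exp (u y₀) = 1 := by
    rw [hl, ← Real.exp_nat_mul, ← Real.exp_add]
    have : (n : ℝ) * (-(u y₀) / n) + u y₀ = 0 := by field_simp; ring
    rw [this, Real.exp_zero]
  have hld : 2 * l < d := by
    by_contra! hcon
    have h1 : d ^ n ≤ (2 * l) ^ n := pow_le_pow_left₀ hd0 hcon n
    have h3 : d ^ n * exp (u y₀) ≤ (2 * l) ^ n * exp (u y₀) := by gcongr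
    rw [mul_pow, mul_assoc, hln] at h3
    linarith
  have hd0' : 0 < d := by linarith
  have hsub : ball y₀ l ⊆ ball x₀ ρ := by
    refine ball_subset_ball' ?_
    rw [dist_eq_norm]; linarith
  have hup : ∀ y ∈ ball y₀ l, exp (u y) ≤ 2 ^ n * exp (u y₀) := by
    intro y hy
    have h1 := hmax (ball_subset_closedBall (hsub hy))
    simp only [mem_ofPred_eq] at h1
    rw [mem_ball, dist_eq_norm] at hy
    have h3 : ‖y - x₀‖ ≤ ‖y - y₀‖ + ‖y₀ - x₀‖ := norm_sub_le_norm_sub_add_norm_sub _ _ _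
    have h4 : (d / 2) ^ n * exp (u y) ≤ (ρ - ‖y - x₀‖) ^ n * exp (u y) := by
      gcongr
      linarith
    have h5 : (d / 2) ^ n * exp (u y) ≤ (d / 2) ^ n * (2 ^ n * exp (u y₀)) := by
      refine h4.trans (h1.trans (le_of_eq ?_))
      rw [← mul_assoc, ← mul_pow, div_mul_cancel₀ _ two_ne_zero]
    exact le_of_mul_le_mul_left h5 (by positivity)
  have hlog : ∀ y ∈ ball y₀ l, u y ≤ u y₀ + n * log 2 := by
    intro y hy
    have h1 := Real.log_le_log (exp_pos _) (hup y hy)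
    rw [Real.log_exp, Real.log_mul (by positivity) (exp_pos _).ne', Real.log_exp,
      Real.log_pow] at h1
    linarith
  have hH := hC (fun x => (u y₀ + n * log 2) - u x) (fun x => - exp (u x)) y₀ l hl0
    (contDiff_const.sub hu) (by have := hu.continuous; fun_prop) ((hsol.mono hsub).const_sub _)
    (fun x hx => by linarith [hlog x hx]) (fun x hx => by
      rw [abs_neg, abs_of_pos (exp_pos _)]
      refine (hup x hx).trans (le_of_eq ?_)
      rw [eq_div_iff (by positivity), mul_assoc, mul_comm (exp _), hln, mul_one])
  have hr0 : 0 < l / (8 * n) := by positivity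
  have hlow : ∀ z ∈ ball y₀ (l / (8 * n)), exp (-C₁) * exp (u y₀) ≤ exp (u z) := by
    intro z hz
    have h1 := hH z hz y₀ (mem_ball_self hr0)
    rw [← Real.exp_add, Real.exp_le_exp]
    have h3 : u y₀ + n * log 2 - u y₀ + 1 = n * log 2 + 1 := by ring
    rw [h3] at h1
    have : 0 ≤ log 2 := Real.log_nonneg (by norm_num)
    have : 0 ≤ n * log 2 := by positivity
    linarith
  have hsub2 : ball y₀ (l / (8 * n)) ⊆ ball x₀ ρ := by
    refine (ball_subset_ball ?_).trans hsub
    exact div_le_self hl0.le (by linarith)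
  have hint : IntegrableOn (fun x => exp (u x)) (ball x₀ ρ) :=
    ((hu.continuous.rexp).continuousOn.integrableOn_compact
      (isCompact_closedBall x₀ ρ)).mono_set ball_subset_closedBall
  have h6 : μ ≤ ∫ x in ball y₀ (l / (8 * n)), exp (u x) := by
    have h7 : μ = ∫ _x in ball y₀ (l / (8 * n)), exp (-C₁) * exp (u y₀) := by
      rw [setIntegral_const, volume_real_ball _ hr0, smul_eq_mul, hμ]
      calc exp (-C₁) * ((1 / (8 * n)) ^ n * ω) =
          exp (-C₁) * ((1 / (8 * n)) ^ n * ω) * (l ^ n * exp (u y₀)) := by rw [hln, mul_one]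
        _ = _ := by rw [div_pow l, div_pow 1, one_pow]; ring
    rw [h7]
    exact setIntegral_mono_on (integrableOn_const measure_ball_lt_top.ne)
      (hint.mono_set hsub2) measurableSet_ball hlow
  have h8 : ∫ x in ball y₀ (l / (8 * n)), exp (u x) ≤ ∫ x in ball x₀ ρ, exp (u x) :=
    setIntegral_mono_set hint (ae_of_all _ fun x => (exp_pos _).le) hsub2.eventuallyLE
  linarith

/-- Finite mass at infinity gives the decay `exp u = O(‖x‖⁻ⁿ)`. -/
theorem exp_mul_norm_pow_le (hn : 2 ≤ n) {u : 𝔼 → ℝ} (hu : ContDiff ℝ 1 u) {R : ℝ}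
    (hsol : WeakSol {x | R < ‖x‖} u (fun x => exp (u x)))
    (hint : IntegrableOn (fun x => exp (u x)) {x | R < ‖x‖}) :
    ∃ R' : ℝ, R ≤ R' ∧ 1 ≤ R' ∧ ∀ x, R' ≤ ‖x‖ → exp (u x) * ‖x‖ ^ n ≤ 4 ^ n := by
  obtain ⟨ε, hε, hsmall⟩ := exp_mul_pow_le_of_small_mass hn
  have htail : Tendsto (fun k : ℕ => ∫ x in {x : 𝔼 | R + k < ‖x‖}, exp (u x)) atTop (𝓝 0) := by
    have h1 := tendsto_setIntegral_of_antitone (μ := (volume : Measure 𝔼))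
      (s := fun k : ℕ => {x : 𝔼 | R + k < ‖x‖}) (f := fun x => exp (u x))
      (fun k => measurableSet_lt measurable_const measurable_norm)
      (fun i j hij x hx => lt_of_le_of_lt (by simpa using hij) (show R + j < ‖x‖ from hx))
      ⟨0, by simpa using hint⟩
    have h3 : ⋂ k : ℕ, {x : 𝔼 | R + k < ‖x‖} = ∅ := by
      refine eq_empty_of_forall_notMem fun x hx => ?_
      obtain ⟨k, hk⟩ := exists_nat_ge (‖x‖ - R)
      have : R + k < ‖x‖ := mem_iInter.1 hx k
      linarith
    rwa [h3, setIntegral_empty] at h1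
  obtain ⟨k, hk⟩ := (htail.eventually (ge_mem_nhds hε)).exists
  refine ⟨max (|R| + 1) (2 * (|R| + k)), ?_, ?_, ?_⟩
  · exact le_max_of_le_left (by linarith [le_abs_self R])
  · exact le_max_of_le_left (by linarith [abs_nonneg R])
  intro x hx
  have hx1 : 1 ≤ ‖x‖ := le_trans (by linarith [abs_nonneg R]) ((le_max_left _ _).trans hx)
  have hx2 : 2 * (|R| + k) ≤ ‖x‖ := (le_max_right _ _).trans hx
  have hsub : ball x (‖x‖ / 2) ⊆ {y | R + k < ‖y‖} := by
    intro y hy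
    rw [mem_ball, dist_eq_norm] at hy
    have h1 : ‖x‖ ≤ ‖y‖ + ‖y - x‖ := by
      rw [norm_sub_rev]; exact norm_le_norm_add_norm_sub' _ _
    have := le_abs_self R
    show R + k < ‖y‖
    linarith
  have hsub' : {y : 𝔼 | R + k < ‖y‖} ⊆ {y | R < ‖y‖} := fun y hy => by
    have h1 : R + k < ‖y‖ := hy
    have : (0 : ℝ) ≤ k := Nat.cast_nonneg k
    show R < ‖y‖
    linarith
  have h1 := hsmall u x (‖x‖ / 2) (by linarith) hu (hsol.mono (hsub.trans hsub'))
    ((setIntegral_mono_set (hint.mono_set hsub') (ae_of_all _ fun x => (exp_pos _).le)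
      hsub.eventuallyLE).trans hk)
  rw [div_pow, div_mul_eq_mul_div, div_le_iff₀ (by positivity), ← mul_pow] at h1
  norm_num at h1
  linarith

end Decay

section SphereHarnack

variable {n : ℕ}

local notation "𝔼" => EuclideanSpace ℝ (Fin n)

/-- The annulus `r / 2 < ‖x‖ < 2 * r`. -/
def annulus (n : ℕ) (r : ℝ) : Set (EuclideanSpace ℝ (Fin n)) := {x | r / 2 < ‖x‖ ∧ ‖x‖ < 2 * r}

lemma exists_orthogonal_nonneg (hn : 2 ≤ n) {r : ℝ} (hr : 0 ≤ r) (y z : 𝔼) :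
    ∃ e : 𝔼, ‖e‖ = r ∧ ⟪y, e⟫_ℝ = 0 ∧ 0 ≤ ⟪e, z⟫_ℝ := by
  have h1 : Module.finrank ℝ (ℝ ∙ y)ᗮ ≠ 0 := by
    have h2 := (ℝ ∙ y).finrank_add_finrank_orthogonal
    have h3 : Module.finrank ℝ (ℝ ∙ y) ≤ 1 := by
      simpa using finrank_span_le_card (R := ℝ) ({y} : Set 𝔼)
    rw [finrank_euclideanSpace_fin] at h2
    omega
  have : Nontrivial (ℝ ∙ y)ᗮ := Module.nontrivial_of_finrank_pos (R := ℝ) (Nat.pos_of_ne_zero h1)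
  obtain ⟨⟨e, he⟩, he0⟩ := exists_ne (0 : (ℝ ∙ y)ᗮ)
  have he0' : e ≠ 0 := fun h => he0 (by simp [h])
  have hye : ⟪y, e⟫_ℝ = 0 := Submodule.mem_orthogonal_singleton_iff_inner_right.1 he
  have hne : ‖e‖ ≠ 0 := norm_ne_zero_iff.2 he0'
  set e' := (r / ‖e‖) • e with he'
  have h4 : ‖e'‖ = r := by
    rw [he', norm_smul, Real.norm_eq_abs, abs_of_nonneg (by positivity), div_mul_cancel₀ _ hne]
  have h5 : ⟪y, e'⟫_ℝ = 0 := by rw [he', inner_smul_right, hye, mul_zero]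
  rcases le_total 0 ⟪e', z⟫_ℝ with h | h
  · exact ⟨e', h4, h5, h⟩
  · refine ⟨-e', by rw [norm_neg, h4], by rw [inner_neg_right, h5, neg_zero], ?_⟩
    rw [inner_neg_left]; linarith

lemma norm_segment_ge {r : ℝ} {y z : 𝔼} (hy : ‖y‖ = r) (hz : ‖z‖ = r)
    (hyz : 0 ≤ ⟪y, z⟫_ℝ) {t : ℝ} (ht : t ∈ Icc (0 : ℝ) 1) :
    5 / 8 * r ≤ ‖y + t • (z - y)‖ ∧ ‖y + t • (z - y)‖ ≤ r := by
  have e : y + t • (z - y) = (1 - t) • y + t • z := by rw [smul_sub, sub_smul, one_smul]; abel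
  obtain ⟨h0, h1⟩ := ht
  constructor
  · refine le_of_sq_le_sq ?_ (norm_nonneg _)
    rw [e, @norm_add_sq_real, norm_smul, norm_smul, hy, hz, inner_smul_left, inner_smul_right,
      Real.norm_eq_abs, Real.norm_eq_abs, abs_of_nonneg h0, abs_of_nonneg (sub_nonneg.2 h1)]
    simp only [conj_trivial]
    have h3 : 0 ≤ (1 - t) * (t * ⟪y, z⟫_ℝ) := by
      have := sub_nonneg.2 h1; positivity
    have h4 : 1 / 2 * r ^ 2 ≤ ((1 - t) * r) ^ 2 + (t * r) ^ 2 := by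
      nlinarith [mul_nonneg (sq_nonneg (2 * t - 1)) (sq_nonneg r)]
    nlinarith [sq_nonneg r]
  · rw [e]
    refine (norm_add_le _ _).trans (le_of_eq ?_)
    rw [norm_smul, norm_smul, hy, hz, Real.norm_eq_abs, Real.norm_eq_abs, abs_of_nonneg h0,
      abs_of_nonneg (sub_nonneg.2 h1)]
    ring

/-- Harnack inequality on spheres. -/
theorem sphere_harnack (hn : 2 ≤ n) {Λ : ℝ} (hΛ : 0 ≤ Λ) : ∃ C : ℝ, 1 ≤ C ∧
    ∀ (w f : 𝔼 → ℝ) (r : ℝ), 0 < r → ContDiff ℝ 1 w → Continuous f →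
      WeakSol (annulus n r) w f → (∀ x ∈ annulus n r, 0 ≤ w x) →
      (∀ x ∈ annulus n r, |f x| ≤ Λ / r ^ n) →
      ∀ y z : 𝔼, ‖y‖ = r → ‖z‖ = r → w y + 1 ≤ C * (w z + 1) := by
  obtain ⟨C, hC1, hC⟩ := local_harnack hn hΛ
  have h2 : (2 : ℝ) ≤ n := by exact_mod_cast hn
  set N : ℕ := 129 * n with hN
  have hN0 : (0 : ℝ) < N := by rw [hN]; push_cast; linarith
  refine ⟨C ^ N * C ^ N, one_le_mul_of_one_le_of_one_le (one_le_pow₀ hC1) (one_le_pow₀ hC1), ?_⟩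
  intro w f r hr hw hf hsol hw0 hfΛ
  have hseg : ∀ y z : 𝔼, ‖y‖ = r → ‖z‖ = r → 0 ≤ ⟪y, z⟫_ℝ → w y + 1 ≤ C ^ N * (w z + 1) := by
    intro y z hy hz hyz
    set p : ℕ → 𝔼 := fun k => y + ((k : ℝ) / N) • (z - y) with hp
    have hstep : ∀ k < N, w (p k) + 1 ≤ C * (w (p (k + 1)) + 1) := by
      intro k hk
      have ht : (k : ℝ) / N ∈ Icc (0 : ℝ) 1 :=
        ⟨by positivity, by rw [div_le_one hN0]; exact_mod_cast hk.le⟩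
      obtain ⟨h3, h4⟩ := norm_segment_ge hy hz hyz ht
      have hsub : ball (p k) (r / 8) ⊆ annulus n r := by
        intro x hx
        rw [mem_ball, dist_eq_norm] at hx
        have h5 : ‖p k‖ ≤ ‖x‖ + ‖x - p k‖ := by
          rw [norm_sub_rev]; exact norm_le_norm_add_norm_sub' _ _
        have h6 : ‖x‖ ≤ ‖p k‖ + ‖x - p k‖ := norm_le_norm_add_norm_sub' _ _
        have h3' : 5 / 8 * r ≤ ‖p k‖ := h3
        have h4' : ‖p k‖ ≤ r := h4
        exact ⟨by linarith, by linarith⟩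
      have hr8 : 0 < r / 8 / (8 * n) := by positivity
      refine hC w f (p k) (r / 8) (by positivity) hw hf (hsol.mono hsub)
        (fun x hx => hw0 x (hsub hx)) (fun x hx => (hfΛ x (hsub hx)).trans ?_) _
        (mem_ball_self hr8) _ ?_
      · gcongr
        linarith
      · rw [mem_ball, dist_eq_norm]
        have h5 : p (k + 1) - p k = (1 / (N : ℝ)) • (z - y) := by
          simp only [hp]
          rw [add_sub_add_left_eq_sub, ← sub_smul]
          congr 1
          push_cast; ring
        rw [h5, norm_smul, Real.norm_eq_abs, abs_of_pos (by positivity)]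
        have h6 : ‖z - y‖ ≤ 2 * r := by
          refine (norm_sub_le _ _).trans ?_
          rw [hy, hz]; linarith
        calc 1 / (N : ℝ) * ‖z - y‖ ≤ 1 / (N : ℝ) * (2 * r) := by gcongr
          _ < r / 8 / (8 * n) := by
            rw [hN]; push_cast
            rw [div_div, one_div_mul_eq_div, div_lt_div_iff₀ (by positivity) (by positivity)]
            nlinarith [mul_pos hr (show (0 : ℝ) < n by linarith)]
    have hind : ∀ k ≤ N, w (p 0) + 1 ≤ C ^ k * (w (p k) + 1) := by
      intro k
      induction k with
      | zero => intro _; simp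
      | succ k ih =>
        intro hk
        refine (ih (by omega)).trans ?_
        rw [pow_succ, mul_assoc]
        exact mul_le_mul_of_nonneg_left (hstep k (by omega)) (by positivity)
    have h7 := hind N le_rfl
    have e0 : p 0 = y := by simp [hp]
    have e1 : p N = z := by
      simp only [hp]; rw [div_self hN0.ne', one_smul]; abel
    rwa [e0, e1] at h7
  intro y z hy hz
  obtain ⟨e, he, hye, hez⟩ := exists_orthogonal_nonneg hn hr.le y z
  calc w y + 1 ≤ C ^ N * (w e + 1) := hseg y e hy he hye.ge
    _ ≤ C ^ N * (C ^ N * (w z + 1)) := by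
        gcongr
        exact hseg e z he hz hez
    _ = _ := by ring

end SphereHarnack

section LogBarrier

variable {n : ℕ}

local notation "𝔼" => EuclideanSpace ℝ (Fin n)

lemma hasFDerivAt_log_norm {x : 𝔼} (hx : x ≠ 0) :
    HasFDerivAt (fun x : 𝔼 => log ‖x‖) ((‖x‖ ^ 2)⁻¹ • innerSL ℝ x) x := by
  have h0 : ‖x‖ ^ 2 ≠ 0 := by positivity
  have h1 := ((hasStrictFDerivAt_norm_sq x).hasFDerivAt.log h0).const_mul (1 / 2)
  have e : (fun x : 𝔼 => log ‖x‖) = fun x => 1 / 2 * log (‖x‖ ^ 2) := by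
    funext y; rw [Real.log_pow]; push_cast; ring
  rw [e]
  refine h1.congr_fderiv ?_
  ext v
  simp
  ring

lemma contDiffAt_log_norm {x : 𝔼} (hx : x ≠ 0) : ContDiffAt ℝ 1 (fun x : 𝔼 => log ‖x‖) x :=
  (contDiffAt_norm ℝ hx).log (norm_ne_zero_iff.2 hx)

/-- The weak `n`-Laplacian of a function of `log ‖x‖`. -/
lemma nPairing_comp_log_norm (hn : 2 ≤ n) {s₀ : ℝ} {H p Q Q' : ℝ → ℝ}
    (hH : ∀ s, s₀ < s → HasDerivAt H (p s) s) (hQp : ∀ s, s₀ < s → Q s = |p s| ^ (n - 2) * p s)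
    (hQ : ∀ s, s₀ < s → HasDerivAt Q (Q' s) s) (hQ' : ContinuousOn Q' (Ioi s₀)) {φ : 𝔼 → ℝ}
    (hφ : ContDiff ℝ 1 φ) (hc : HasCompactSupport φ)
    (hs : tsupport φ ⊆ {x | exp s₀ < ‖x‖}) :
    Integrable (fun x => Q' (log ‖x‖) * exp (-(n * log ‖x‖)) * φ x) ∧
    nPairing (fun x => H (log ‖x‖)) φ =
      - ∫ x, Q' (log ‖x‖) * exp (-(n * log ‖x‖)) * φ x := by
  set D : Set 𝔼 := {x | exp s₀ < ‖x‖} with hD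
  have hDo : IsOpen D := isOpen_lt continuous_const continuous_norm
  have hx0 : ∀ x ∈ D, x ≠ 0 := fun x hx => norm_pos_iff.1 ((exp_pos _).trans hx)
  have hxs : ∀ x ∈ D, s₀ < log ‖x‖ := fun x hx =>
    (Real.lt_log_iff_exp_lt (norm_pos_iff.2 (hx0 x hx))).2 hx
  have hgrad : ∀ x ∈ D, gradient (fun x => H (log ‖x‖)) x = (p (log ‖x‖) * (‖x‖ ^ 2)⁻¹) • x := by
    intro x hx
    have h1 := (hH _ (hxs x hx)).comp_hasFDerivAt (f := fun x : 𝔼 => log ‖x‖) x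
      (hasFDerivAt_log_norm (hx0 x hx))
    refine ext_inner_right ℝ fun v => ?_
    rw [inner_gradient_left, inner_smul_left]
    have h3 : HasFDerivAt (fun x : 𝔼 => H (log ‖x‖)) _ x := h1
    rw [h3.fderiv]
    simp
    ring
  set T : ℝ → ℝ := fun s => Q s * exp (-(n * s)) with hT
  have hTd : ∀ s, s₀ < s → HasDerivAt T ((Q' s - n * Q s) * exp (-(n * s))) s := by
    intro s hs
    have h1 : HasDerivAt (fun s : ℝ => exp (-(n * s))) (exp (-(n * s)) * (-(n * 1))) s :=
      (((hasDerivAt_id s).const_mul (n : ℝ)).neg).exp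
    refine ((hQ s hs).mul h1).congr_deriv ?_
    ring
  have hTc : ContDiffOn ℝ 1 T (Ioi s₀) := by
    rw [contDiffOn_one_iff_derivWithin (uniqueDiffOn_Ioi _)]
    refine ⟨fun s hs => (hTd s hs).differentiableAt.differentiableWithinAt, ?_⟩
    have hQc : ContinuousOn Q (Ioi s₀) := fun s hs => (hQ s hs).continuousAt.continuousWithinAt
    have : ContinuousOn (fun s => (Q' s - n * Q s) * exp (-(n * s))) (Ioi s₀) := by fun_prop
    refine this.congr fun s hs => ?_
    rw [(hTd s hs).hasDerivWithinAt.derivWithin (uniqueDiffOn_Ioi _ s hs)]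
  set ψ : 𝔼 → ℝ := fun x => φ x * T (log ‖x‖) with hψ
  have hψ0 : ∀ x, x ∉ tsupport φ → ψ x = 0 := fun x hx => by
    simp [hψ, image_eq_zero_of_notMem_tsupport hx]
  have hψC : ContDiff ℝ 1 ψ := by
    refine contDiff_of_zero_off hDo (isClosed_tsupport φ) hs (hφ.contDiffOn.mul ?_) hψ0
    refine hTc.comp (t := Ioi s₀) (g := T) (fun x hx => ?_) hxs
    exact (contDiffAt_log_norm (hx0 x hx)).contDiffWithinAt
  have hψc : HasCompactSupport ψ := HasCompactSupport.intro hc hψ0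
  have hfd0 : ∀ x, x ∉ tsupport φ → fderiv ℝ φ x = 0 := fun x hx =>
    image_eq_zero_of_notMem_tsupport (fun h => hx (tsupport_fderiv_subset ℝ h))
  have hψd0 : ∀ x, x ∉ tsupport φ → fderiv ℝ ψ x = 0 := fun x hx =>
    image_eq_zero_of_notMem_tsupport (fun h => hx
      (tsupport_subset_of_zero_off (isClosed_tsupport φ) hψ0 (tsupport_fderiv_subset ℝ h)))
  have hψd : ∀ x, fderiv ℝ φ x x * T (log ‖x‖) = fderiv ℝ ψ x x + n * ψ x -
      Q' (log ‖x‖) * exp (-(n * log ‖x‖)) * φ x := by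
    intro x
    by_cases hx : x ∈ tsupport φ
    · have hxD := hs hx
      have h1 := (hTd _ (hxs x hxD)).comp_hasFDerivAt (f := fun x : 𝔼 => log ‖x‖) x
        (hasFDerivAt_log_norm (hx0 x hxD))
      have h3 : HasFDerivAt ψ _ x := (hφ.differentiable one_ne_zero x).hasFDerivAt.mul h1
      rw [h3.fderiv]
      have hn0 : ‖x‖ ≠ 0 := norm_ne_zero_iff.2 (hx0 x hxD)
      simp [hψ, hT]
      field_simp
      ring
    · rw [hfd0 x hx, hψd0 x hx, hψ0 x hx, image_eq_zero_of_notMem_tsupport hx]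
      simp
  have hpt : ∀ x, ‖gradient (fun x => H (log ‖x‖)) x‖ ^ (n - 2) *
      fderiv ℝ φ x (gradient (fun x => H (log ‖x‖)) x) = fderiv ℝ φ x x * T (log ‖x‖) := by
    intro x
    by_cases hx : x ∈ tsupport φ
    · have hxD := hs hx
      have hr : 0 < ‖x‖ := norm_pos_iff.2 (hx0 x hxD)
      rw [hgrad x hxD, map_smul, norm_smul, smul_eq_mul]
      simp only [hT]
      rw [hQp _ (hxs x hxD), Real.norm_eq_abs, abs_mul, abs_of_pos (by positivity : 0 < (‖x‖^2)⁻¹),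
        Real.exp_neg, Real.exp_nat_mul, Real.exp_log hr]
      obtain ⟨m, rfl⟩ : ∃ m, n = m + 2 := ⟨n - 2, by omega⟩
      simp only [show m + 2 - 2 = m by omega]
      rw [mul_pow, mul_pow, pow_add ‖x‖ m 2, inv_pow, ← pow_mul]
      field_simp
      ring
    · rw [hfd0 x hx]; simp
  have hI1 : Integrable (fun x => fderiv ℝ ψ x x) :=
    ((hψC.continuous_fderiv one_ne_zero).clm_apply continuous_id).integrable_of_hasCompactSupport
      (HasCompactSupport.intro hc fun x hx => by simp [hψd0 x hx])
  have hI2 : Integrable ψ := hψC.continuous.integrable_of_hasCompactSupport hψc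
  have hI3 : Integrable (fun x => Q' (log ‖x‖) * exp (-(n * log ‖x‖)) * φ x) := by
    refine Continuous.integrable_of_hasCompactSupport ?_
      (HasCompactSupport.intro hc fun x hx => by simp [image_eq_zero_of_notMem_tsupport hx])
    refine continuous_of_zero_off hDo (isClosed_tsupport φ) hs ?_
      (fun x hx => by simp [image_eq_zero_of_notMem_tsupport hx])
    have hl : ContinuousOn (fun x : 𝔼 => log ‖x‖) D := fun x hx =>
      (contDiffAt_log_norm (hx0 x hx)).continuousAt.continuousWithinAt
    have hQl : ContinuousOn (fun x : 𝔼 => Q' (log ‖x‖)) D := hQ'.comp hl hxs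
    exact (hQl.mul (continuousOn_const.mul hl).neg.rexp).mul hφ.continuous.continuousOn
  refine ⟨hI3, ?_⟩
  unfold nPairing
  simp_rw [hpt, hψd]
  have h0 := integral_fderiv_sub hψC hψc 0
  simp only [sub_zero] at h0
  have hI4 : Integrable (fun x => fderiv ℝ ψ x x + n * ψ x) := hI1.add (hI2.const_mul _)
  rw [integral_sub hI4 hI3, integral_add hI1 (hI2.const_mul _),
    integral_const_mul, h0]
  ring

end LogBarrier

section ExteriorSolution

variable {n : ℕ}

local notation "𝔼" => EuclideanSpace ℝ (Fin n)

/-- `-v` solves the `n`-Liouville equation outside the ball of radius `R`, with the decay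
`exp (-v) ≤ A / ‖x‖ ^ n`. -/
structure IsExteriorSol (R A : ℝ) (v : 𝔼 → ℝ) : Prop where
  contDiff : ContDiff ℝ 1 v
  weakSol : WeakSol {x | R < ‖x‖} v (fun x => -exp (-v x))
  decay : ∀ x, R ≤ ‖x‖ → exp (-v x) * ‖x‖ ^ n ≤ A
  one_le : 1 ≤ R

lemma exists_norm_eq_exp (hn : 2 ≤ n) (t : ℝ) : ∃ x : 𝔼, ‖x‖ = exp t := by
  refine ⟨EuclideanSpace.single ⟨0, by omega⟩ (exp t), ?_⟩
  rw [PiLp.norm_single, Real.norm_eq_abs, abs_of_pos (exp_pos t)]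

/-- Comparison on the closed annulus `t₁ ≤ log ‖x‖ ≤ t₂`. -/
lemma annulus_comparison (hn : 2 ≤ n) {t₁ t₂ : ℝ} {u h : 𝔼 → ℝ}
    (hu : ContDiffOn ℝ 1 u {x | x ≠ 0}) (hh : ContDiffOn ℝ 1 h {x | x ≠ 0})
    (hw : ∀ φ : 𝔼 → ℝ, ContDiff ℝ 1 φ → HasCompactSupport φ →
      tsupport φ ⊆ {x | exp t₁ < ‖x‖} → (∀ x, 0 ≤ φ x) → nPairing u φ ≤ nPairing h φ)
    (h₁ : ∀ x, ‖x‖ = exp t₁ → u x ≤ h x) (h₂ : ∀ x, ‖x‖ = exp t₂ → u x ≤ h x) :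
    ∀ x, exp t₁ ≤ ‖x‖ → ‖x‖ ≤ exp t₂ → u x ≤ h x := by
  set D : Set 𝔼 := {x | exp t₁ < ‖x‖ ∧ ‖x‖ < exp t₂} with hD
  set K : Set 𝔼 := {x | exp t₁ ≤ ‖x‖ ∧ ‖x‖ ≤ exp t₂} with hK
  have hDo : IsOpen D := (isOpen_lt continuous_const continuous_norm).inter
    (isOpen_lt continuous_norm continuous_const)
  have hKc : IsCompact K := by
    refine Metric.isCompact_of_isClosed_isBounded ((isClosed_le continuous_const
      continuous_norm).inter (isClosed_le continuous_norm continuous_const)) ?_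
    exact (isBounded_closedBall (x := (0 : 𝔼)) (r := exp t₂)).subset fun x hx => by
      simpa using hx.2
  have hDK : D ⊆ K := fun x hx => ⟨hx.1.le, hx.2.le⟩
  have hK0 : K ⊆ {x | x ≠ 0} := fun x hx => norm_pos_iff.1 ((exp_pos _).trans_le hx.1)
  have hb : ∀ x ∈ K, x ∉ D → u x ≤ h x := by
    intro x hx hxD
    rcases hx.1.eq_or_lt with h | h
    · exact h₁ x h.symm
    · rcases hx.2.eq_or_lt with h' | h'
      · exact h₂ x h'
      · exact absurd ⟨h, h'⟩ hxD
  have hmain := nLaplace_comparison hn hDo hKc hDK (hu.mono (hDK.trans hK0))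
    (hh.mono (hDK.trans hK0)) (hu.continuousOn.mono hK0) (hh.continuousOn.mono hK0)
    (fun φ h1 h2 h3 h4 => hw φ h1 h2 (h3.trans fun x hx => hx.1) h4) hb
  intro x hx1 hx2
  by_cases hxD : x ∈ D
  · exact hmain x hxD
  · exact hb x ⟨hx1, hx2⟩ hxD

lemma IsExteriorSol.le_log (hn : 2 ≤ n) {R A : ℝ} {v : 𝔼 → ℝ} (hv : IsExteriorSol R A v)
    {t₁ t₂ a b : ℝ} (ht : R ≤ exp t₁) (h₁ : ∀ x, ‖x‖ = exp t₁ → v x ≤ a + b * t₁)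
    (h₂ : ∀ x, ‖x‖ = exp t₂ → v x ≤ a + b * t₂) :
    ∀ x, exp t₁ ≤ ‖x‖ → ‖x‖ ≤ exp t₂ → v x ≤ a + b * log ‖x‖ := by
  refine annulus_comparison hn hv.contDiff.contDiffOn (contDiffOn_const.add
    (contDiffOn_const.mul fun x hx => (contDiffAt_log_norm hx).contDiffWithinAt)) ?_ ?_ ?_
  · intro φ hφ hc hs h0
    rw [hv.weakSol φ hφ hc (hs.trans fun x hx => ht.trans_lt hx)]
    have h1 := (nPairing_comp_log_norm hn (s₀ := t₁) (H := fun s => a + b * s) (p := fun _ => b)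
      (Q := fun _ => |b| ^ (n - 2) * b) (Q' := fun _ => 0)
      (fun s _ => by simpa using ((hasDerivAt_id s).const_mul b).const_add a)
      (fun _ _ => rfl) (fun s _ => hasDerivAt_const s _) continuousOn_const hφ hc hs).2
    rw [h1]
    simp only [zero_mul, integral_zero, neg_zero]
    refine integral_nonpos fun x => ?_
    have := exp_pos (-v x)
    simp only [Pi.zero_apply]
    nlinarith [h0 x]
  · intro x hx; simpa [hx] using h₁ x hx
  · intro x hx; simpa [hx] using h₂ x hx

/-- A logarithmic lower bound on the two boundary spheres of an annulus propagates inside. -/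
lemma log_barrier (hn : 2 ≤ n) {B δ : ℝ} (hB : 0 ≤ B) (hδ : 0 < δ) : ∃ K T₁ : ℝ, 0 ≤ T₁ ∧
    ∀ (R A : ℝ) (v : 𝔼 → ℝ), IsExteriorSol R A v → ∀ t₁ t₂ a L : ℝ, R ≤ exp t₁ → T₁ ≤ t₁ →
      2 ≤ a → (∀ x, exp t₁ ≤ ‖x‖ → exp (-v x) * ‖x‖ ^ n ≤ B * exp (-(δ * log ‖x‖))) →
      (∀ x, ‖x‖ = exp t₁ → a * t₁ - L ≤ v x) → (∀ x, ‖x‖ = exp t₂ → a * t₂ - L ≤ v x) →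
      ∀ x, exp t₁ ≤ ‖x‖ → ‖x‖ ≤ exp t₂ → a * log ‖x‖ - L - K ≤ v x := by
  set K := B / δ ^ 2 with hK
  have hK0 : 0 ≤ K := by positivity
  have hKB : K * δ ^ 2 = B := by rw [hK]; field_simp
  refine ⟨K, K, hK0, ?_⟩
  intro R A v hv t₁ t₂ a L hR hT ha hF h₁ h₂
  have hexp : ∀ s : ℝ, K ≤ s → K * δ * exp (-(δ * s)) ≤ 1 := by
    intro s hs
    have h1 := Real.add_one_le_exp (δ * s)
    rw [Real.exp_neg, ← div_eq_mul_inv, div_le_one (exp_pos _)]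
    nlinarith [mul_le_mul_of_nonneg_left hs hδ.le]
  have ht0 : 0 ≤ t₁ := hK0.trans hT
  have hp : ∀ s, t₁ < s → 1 ≤ a - K * δ * exp (-(δ * s)) := fun s hs => by
    have := hexp s (hT.trans hs.le)
    linarith
  have hle1 : ∀ s : ℝ, 0 ≤ s → exp (-(δ * s)) ≤ 1 := fun s hs =>
    Real.exp_le_one_iff.2 (by nlinarith)
  set h : 𝔼 → ℝ := fun x => a * log ‖x‖ + K * exp (-(δ * log ‖x‖)) - (L + K) with hh
  have hlog : ContDiffOn ℝ 1 (fun x : 𝔼 => log ‖x‖) {x | x ≠ 0} := fun x hx =>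
    (contDiffAt_log_norm hx).contDiffWithinAt
  have hlow : ∀ x : 𝔼, exp t₁ ≤ ‖x‖ → 0 ≤ log ‖x‖ := fun x hx =>
    ht0.trans ((Real.le_log_iff_exp_le ((exp_pos _).trans_le hx)).2 hx)
  have hhb : ∀ x, exp t₁ ≤ ‖x‖ → h x ≤ a * log ‖x‖ - L := fun x hx => by
    have := mul_le_mul_of_nonneg_left (hle1 _ (hlow x hx)) hK0
    simp only [hh]; linarith
  have hmain : ∀ x, exp t₁ ≤ ‖x‖ → ‖x‖ ≤ exp t₂ → h x ≤ v x := by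
    intro x hx1 hx2
    have h12 : exp t₁ ≤ exp t₂ := hx1.trans hx2
    refine annulus_comparison hn (((contDiffOn_const.mul hlog).add (contDiffOn_const.mul
      (contDiffOn_const.mul hlog).neg.exp)).sub contDiffOn_const) hv.contDiff.contDiffOn
      ?_ ?_ ?_ x hx1 hx2
    · intro φ hφ hc hs h0
      rw [hv.weakSol φ hφ hc (hs.trans fun x hx => hR.trans_lt hx)]
      have hE : ∀ s : ℝ, HasDerivAt (fun s => exp (-(δ * s))) (exp (-(δ * s)) * (-(δ * 1))) s :=
        fun s => (((hasDerivAt_id s).const_mul δ).neg).exp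
      obtain ⟨h1, h2⟩ := nPairing_comp_log_norm hn (s₀ := t₁)
        (H := fun s => a * s + K * exp (-(δ * s)) - (L + K))
        (p := fun s => a - K * δ * exp (-(δ * s)))
        (Q := fun s => (a - K * δ * exp (-(δ * s))) ^ (n - 1))
        (Q' := fun s => ((n - 1 : ℕ) : ℝ) * (a - K * δ * exp (-(δ * s))) ^ (n - 2) *
          (K * δ ^ 2 * exp (-(δ * s))))
        (fun s _ => by
          refine ((((hasDerivAt_id s).const_mul a).add ((hE s).const_mul K)).sub_const
            (L + K)).congr_deriv ?_
          ring)
        (fun s hs => by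
          rw [abs_of_pos (zero_lt_one.trans_le (hp s hs)), ← pow_succ]
          congr 1; omega)
        (fun s _ => by
          refine ((((hE s).const_mul (K * δ)).const_sub a).pow (n - 1)).congr_deriv ?_
          rw [show n - 1 - 1 = n - 2 by omega]
          ring)
        (by fun_prop) hφ hc hs
      have h3 : Integrable (fun x => exp (-v x) * φ x) :=
        (hv.contDiff.continuous.neg.rexp.mul hφ.continuous).integrable_of_hasCompactSupport
          hc.mul_left
      rw [h2]
      simp only [neg_mul, integral_neg, neg_le_neg_iff]
      refine integral_mono h3 h1 fun x => ?_
      by_cases hx : x ∈ tsupport φ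
      · have hxs : exp t₁ < ‖x‖ := hs hx
        have hx0 : 0 < ‖x‖ := (exp_pos _).trans hxs
        refine mul_le_mul_of_nonneg_right ?_ (h0 x)
        have h5 := hF x hxs.le
        rw [Real.exp_neg (n * log ‖x‖), Real.exp_nat_mul, Real.exp_log hx0, ← div_eq_mul_inv,
          le_div_iff₀ (by positivity)]
        refine h5.trans ?_
        rw [hKB]
        refine le_mul_of_one_le_left (by positivity) ?_
        have h6 : (1 : ℝ) ≤ ((n - 1 : ℕ) : ℝ) := by exact_mod_cast (by omega : 1 ≤ n - 1)
        exact one_le_mul_of_one_le_of_one_le h6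
          (one_le_pow₀ (hp _ ((Real.lt_log_iff_exp_lt hx0).2 hxs)))
      · simp [image_eq_zero_of_notMem_tsupport hx]
    · intro y hy
      have h7 := hhb y hy.ge
      have h8 := h₁ y hy
      simp only [hy, log_exp] at h7
      linarith
    · intro y hy
      have h7 := hhb y (h12.trans hy.ge)
      have h8 := h₂ y hy
      simp only [hy, log_exp] at h7
      linarith
  intro x hx1 hx2
  have h9 := hmain x hx1 hx2
  have h10 : 0 ≤ K * exp (-(δ * log ‖x‖)) := by positivity
  simp only [hh] at h9
  linarith

lemma IsExteriorSol.decay_pos {R A : ℝ} {v : 𝔼 → ℝ} (hn : 2 ≤ n) (hv : IsExteriorSol R A v) :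
    0 < A := by
  obtain ⟨x, hx⟩ := exists_norm_eq_exp hn (log R)
  have hR : 0 < R := zero_lt_one.trans_le hv.one_le
  rw [Real.exp_log hR] at hx
  have h1 := hv.decay x hx.ge
  rw [hx] at h1
  exact lt_of_lt_of_le (by positivity) h1

lemma IsExteriorSol.log_le {R A : ℝ} {v : 𝔼 → ℝ} (hv : IsExteriorSol R A v) {x : 𝔼}
    (hx : R ≤ ‖x‖) : n * log ‖x‖ - log A ≤ v x := by
  have hx0 : 0 < ‖x‖ := zero_lt_one.trans_le (hv.one_le.trans hx)
  have h1 := Real.log_le_log (by positivity) (hv.decay x hx)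
  rw [Real.log_mul (exp_pos _).ne' (by positivity), Real.log_exp, Real.log_pow] at h1
  linarith

lemma IsExteriorSol.neg_log_le {R A : ℝ} {v : 𝔼 → ℝ} (hv : IsExteriorSol R A v)
    {x : 𝔼} (hx : R ≤ ‖x‖) : 0 ≤ v x + log A := by
  have h1 := hv.log_le hx
  have h2 := Real.log_nonneg (hv.one_le.trans hx)
  have h3 : 0 ≤ n * log ‖x‖ := by positivity
  linarith

lemma IsExteriorSol.annulus_subset {R A : ℝ} {v : 𝔼 → ℝ} (_ : IsExteriorSol R A v) {r : ℝ}
    (hr : 2 * R ≤ r) : annulus n r ⊆ {x | R < ‖x‖} := fun x hx => by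
  have := hx.1
  simp only [mem_ofPred_eq]
  linarith

lemma IsExteriorSol.exp_neg_le_of_mem_annulus {R A : ℝ} {v : 𝔼 → ℝ} (hv : IsExteriorSol R A v)
    {r : ℝ} (hr : 2 * R ≤ r) {x : 𝔼} (hx : x ∈ annulus n r) : exp (-v x) ≤ A * 2 ^ n / r ^ n := by
  have h1 := hv.decay x (hv.annulus_subset hr hx).le
  have hr0 : 0 < r := by linarith [hv.one_le]
  have h2 : r ^ n ≤ 2 ^ n * ‖x‖ ^ n := by
    rw [← mul_pow]
    exact pow_le_pow_left₀ hr0.le (by linarith [hx.1]) _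
  rw [le_div_iff₀ (by positivity)]
  calc exp (-v x) * r ^ n ≤ exp (-v x) * (2 ^ n * ‖x‖ ^ n) := by gcongr
    _ = exp (-v x) * ‖x‖ ^ n * 2 ^ n := by ring
    _ ≤ A * 2 ^ n := by gcongr

/-- Harnack inequality for `v` on large spheres. -/
lemma IsExteriorSol.le_mul_add (hn : 2 ≤ n) {R A : ℝ} {v : 𝔼 → ℝ} (hv : IsExteriorSol R A v) :
    ∃ C D : ℝ, 1 ≤ C ∧ ∀ y z : 𝔼, ‖y‖ = ‖z‖ → 2 * R ≤ ‖z‖ → v y ≤ C * v z + D := by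
  have hA := hv.decay_pos hn
  obtain ⟨C, hC1, hC⟩ := sphere_harnack hn (by positivity : 0 ≤ A * 2 ^ n)
  refine ⟨C, C * (log A + 1) - (log A + 1), hC1, fun y z hyz hz => ?_⟩
  have hz0 : 0 < ‖z‖ := by linarith [hv.one_le]
  have h1 := hC (fun x => log A + v x) (fun x => -exp (-v x)) ‖z‖ hz0
    (contDiff_const.add hv.contDiff) hv.contDiff.continuous.neg.rexp.neg
    ((hv.weakSol.mono (hv.annulus_subset hz)).const_add _)
    (fun x hx => by rw [add_comm]; exact hv.neg_log_le (hv.annulus_subset hz hx).le)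
    (fun x hx => by
      rw [abs_neg, abs_of_pos (exp_pos _)]; exact hv.exp_neg_le_of_mem_annulus hz hx) y z hyz rfl
  linarith

end ExteriorSolution

section ConvexRay

lemma ConvexOn.add_mul_sub_le {V : ℝ → ℝ} {T₀ t s a : ℝ} (hV : ConvexOn ℝ (Ici T₀) V)
    (ht : T₀ ≤ t) (hts : t < s) (ha : a * (s - t) ≤ V s - V t) {x : ℝ} (hx : s ≤ x) :
    V s + a * (x - s) ≤ V x := by
  rcases hx.eq_or_lt with rfl | hx
  · simp
  have h1 := hV.slope_mono_adjacent (x := t) (y := s) (z := x) ht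
    (show T₀ ≤ x by linarith) hts hx
  have h2 : a ≤ (V s - V t) / (s - t) := (le_div_iff₀ (sub_pos.2 hts)).2 ha
  have h3 := (le_div_iff₀ (sub_pos.2 hx)).1 (h2.trans h1)
  linarith

lemma ConvexOn.monotoneOn_of_slope_nonneg {V : ℝ → ℝ} {T₀ t s : ℝ} (hV : ConvexOn ℝ (Ici T₀) V)
    (ht : T₀ ≤ t) (hts : t < s) (h : V t ≤ V s) : MonotoneOn V (Ici s) := by
  intro x hx y _ hxy
  have hx' : s ≤ x := hx
  have h1 := hV.add_mul_sub_le ht hts (a := 0) (by linarith) hx'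
  have h2 := hV.add_mul_sub_le ht (s := x) (by linarith) (a := 0) (by linarith) hxy
  linarith

end ConvexRay

section ExteriorAsymptotics

variable {n : ℕ}

local notation "𝔼" => EuclideanSpace ℝ (Fin n)

lemma exists_sphere_sup (hn : 2 ≤ n) {v : 𝔼 → ℝ} (hv : Continuous v) : ∃ V : ℝ → ℝ, ∀ t,
    (∀ x, ‖x‖ = exp t → v x ≤ V t) ∧ ∃ x, ‖x‖ = exp t ∧ v x = V t := by
  have h : ∀ t : ℝ, ∃ M : ℝ, (∀ x, ‖x‖ = exp t → v x ≤ M) ∧ ∃ x, ‖x‖ = exp t ∧ v x = M := by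
    intro t
    obtain ⟨x₀, hx₀⟩ := exists_norm_eq_exp hn t
    obtain ⟨x, hx, hmax⟩ := (isCompact_sphere (0 : 𝔼) (exp t)).exists_isMaxOn
      ⟨x₀, by simpa using hx₀⟩ hv.continuousOn
    exact ⟨v x, fun y hy => hmax (by simpa using hy), x, by simpa using hx, rfl⟩
  choose V hV using h
  exact ⟨V, hV⟩

lemma IsExteriorSol.convexOn_sphere_sup (hn : 2 ≤ n) {R A : ℝ} {v : 𝔼 → ℝ}
    (hv : IsExteriorSol R A v) {V : ℝ → ℝ}
    (hV : ∀ t, (∀ x, ‖x‖ = exp t → v x ≤ V t) ∧ ∃ x, ‖x‖ = exp t ∧ v x = V t) :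
    ConvexOn ℝ (Ici (log R)) V := by
  have hR : 0 < R := zero_lt_one.trans_le hv.one_le
  refine LinearOrder.convexOn_of_lt (convex_Ici _) ?_
  intro t₁ h₁ t₂ _ h12 p q hp hq hpq
  have h₁' : log R ≤ t₁ := h₁
  simp only [smul_eq_mul]
  set t := p * t₁ + q * t₂ with ht
  obtain ⟨x, hx, hxV⟩ := (hV t).2
  set b := (V t₂ - V t₁) / (t₂ - t₁) with hb
  have hb' : b * (t₂ - t₁) = V t₂ - V t₁ := div_mul_cancel₀ _ (sub_pos.2 h12).ne'
  have hp1 : p = 1 - q := by linarith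
  have ht1 : t = t₁ + q * (t₂ - t₁) := by rw [ht, hp1]; ring
  have ht2 : t = t₂ - p * (t₂ - t₁) := by rw [ht, hp1]; ring
  have h := hv.le_log hn (a := V t₁ - b * t₁) (b := b) (t₂ := t₂)
    ((Real.log_le_iff_le_exp hR).1 h₁')
    (fun y hy => by linarith [(hV t₁).1 y hy]) (fun y hy => by linarith [(hV t₂).1 y hy]) x
    (by rw [hx, Real.exp_le_exp, ht1]; nlinarith)
    (by rw [hx, Real.exp_le_exp, ht2]; nlinarith)
  rw [hxV, hx, Real.log_exp] at h
  refine h.trans (le_of_eq ?_)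
  rw [ht1, hp1]
  linear_combination q * hb'

/-- A super-critical lower bound at infinity lets logarithmic lower bounds on a fixed sphere
propagate to infinity. -/
lemma IsExteriorSol.log_lower_extend (hn : 2 ≤ n) {R A : ℝ} {v : 𝔼 → ℝ}
    (hv : IsExteriorSol R A v) {b C s₀ : ℝ} (hb : n < b)
    (hlow : ∀ x, exp s₀ ≤ ‖x‖ → b * log ‖x‖ - C ≤ v x) (T₀ : ℝ) :
    ∃ T K : ℝ, T₀ ≤ T ∧ 0 ≤ T ∧ R ≤ exp T ∧ ∀ a L : ℝ, 2 ≤ a →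
      (∀ x, ‖x‖ = exp T → a * T - L ≤ v x) →
      (∃ a' C' s : ℝ, a < a' ∧ ∀ x, exp s ≤ ‖x‖ → a' * log ‖x‖ - C' ≤ v x) →
      ∀ x, exp T ≤ ‖x‖ → a * log ‖x‖ - L - K ≤ v x := by
  obtain ⟨K, T₁, hT₁, hbar⟩ := log_barrier hn (exp_pos C).le (sub_pos.2 hb)
  have hR : 0 < R := zero_lt_one.trans_le hv.one_le
  set T := max (max T₀ T₁) (max s₀ (log R)) with hT
  have h0 : T₀ ≤ T := (le_max_left _ _).trans (le_max_left _ _)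
  have h1 : T₁ ≤ T := (le_max_right _ _).trans (le_max_left _ _)
  have h2 : s₀ ≤ T := (le_max_left _ _).trans (le_max_right _ _)
  have h3 : log R ≤ T := (le_max_right _ _).trans (le_max_right _ _)
  have h3' : R ≤ exp T := (Real.log_le_iff_le_exp hR).1 h3
  refine ⟨T, K, h0, hT₁.trans h1, h3', ?_⟩
  rintro a L ha hL ⟨a', C', s, haa', ha'⟩ x hx
  have hdec : ∀ x, exp T ≤ ‖x‖ → exp (-v x) * ‖x‖ ^ n ≤
      exp C * exp (-((b - n) * log ‖x‖)) := by
    intro x hx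
    have hx0 : 0 < ‖x‖ := (exp_pos _).trans_le hx
    have h4 := hlow x ((Real.exp_le_exp.2 h2).trans hx)
    calc exp (-v x) * ‖x‖ ^ n = exp (-v x) * exp (n * log ‖x‖) := by
          rw [Real.exp_nat_mul, Real.exp_log hx0]
      _ = exp (-v x + n * log ‖x‖) := (Real.exp_add _ _).symm
      _ ≤ exp (C + -((b - n) * log ‖x‖)) := by
          rw [Real.exp_le_exp]; linarith
      _ = _ := Real.exp_add _ _
  set t₂ := max (max s (log ‖x‖)) ((C' - L) / (a' - a)) with ht₂
  have h5 : s ≤ t₂ := (le_max_left _ _).trans (le_max_left _ _)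
  have h6 : log ‖x‖ ≤ t₂ := (le_max_right _ _).trans (le_max_left _ _)
  have h7 : C' - L ≤ t₂ * (a' - a) := (div_le_iff₀ (sub_pos.2 haa')).1 (le_max_right _ _)
  refine hbar R A v hv T t₂ a L h3' h1 ha hdec hL (fun y hy => ?_) x hx
    ((Real.log_le_iff_le_exp ((exp_pos _).trans_le hx)).1 h6)
  have h8 := ha' y (by rw [hy, Real.exp_le_exp]; exact h5)
  rw [hy, Real.log_exp] at h8
  linarith

/-- A function growing at most like `n log ‖x‖` cannot have `exp (-v)` integrable at infinity. -/
lemma not_integrableOn_exp_neg (hn : 2 ≤ n) {v : 𝔼 → ℝ} (hv : Continuous v) {C T : ℝ}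
    (h : ∀ x, exp T ≤ ‖x‖ → v x ≤ n * log ‖x‖ + C) :
    ¬ IntegrableOn (fun x => exp (-v x)) {x | exp T < ‖x‖} := by
  intro hint
  have hn0 : Nontrivial 𝔼 := by
    have : Nonempty (Fin n) := ⟨⟨0, by omega⟩⟩
    infer_instance
  have hm : MeasurableSet {x : 𝔼 | exp T < ‖x‖} :=
    (isOpen_lt continuous_const continuous_norm).measurableSet
  have h1 : IntegrableOn (fun x : 𝔼 => (‖x‖ ^ n)⁻¹) {x | exp T < ‖x‖} := by
    refine Integrable.mono' (hint.const_mul (exp C)) ?_ ?_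
    · exact (continuous_norm.measurable.pow_const n).inv.aestronglyMeasurable
    · refine (ae_restrict_iff' hm).2 (Eventually.of_forall fun x hx => ?_)
      have hx' : exp T < ‖x‖ := hx
      have hx0 : 0 < ‖x‖ := (exp_pos _).trans hx'
      rw [Real.norm_eq_abs, abs_of_nonneg (by positivity), ← Real.exp_add]
      calc (‖x‖ ^ n)⁻¹ = exp (-(n * log ‖x‖)) := by
            rw [Real.exp_neg, Real.exp_nat_mul, Real.exp_log hx0]
        _ ≤ _ := by
            rw [Real.exp_le_exp]; linarith [h x hx'.le]
  set f : ℝ → ℝ := (Ioi (exp T)).indicator fun y => (y ^ n)⁻¹ with hf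
  have h2 : Integrable (fun x : 𝔼 => f ‖x‖) := by
    rw [← integrable_indicator_iff hm] at h1
    refine h1.congr (Eventually.of_forall fun x => ?_)
    simp [hf, indicator]
  rw [integrable_fun_norm_addHaar, finrank_euclideanSpace_fin] at h2
  have h3 := h2.mono_set (Ioi_subset_Ioi (exp_pos T).le)
  refine not_integrableOn_Ioi_inv (a := exp T) (h3.congr_fun (fun y hy => ?_) measurableSet_Ioi)
  have hy0 : 0 < y := (exp_pos T).trans hy
  simp only [hf, indicator_of_mem hy, smul_eq_mul]
  obtain ⟨m, rfl⟩ : ∃ m, n = m + 1 := ⟨n - 1, by omega⟩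
  rw [Nat.add_sub_cancel, pow_succ]
  field_simp

/-- The growth rate of an exterior solution is finite. -/
lemma IsExteriorSol.bddAbove_slope (hn : 2 ≤ n) {R A : ℝ} {v : 𝔼 → ℝ}
    (hv : IsExteriorSol R A v) {V : ℝ → ℝ}
    (hV : ∀ t, (∀ x, ‖x‖ = exp t → v x ≤ V t) ∧ ∃ x, ‖x‖ = exp t ∧ v x = V t) :
    ∃ M, ∀ t s, log R ≤ t → t < s → V s - V t ≤ M * (s - t) := by
  by_contra! hcon
  have hR : 0 < R := zero_lt_one.trans_le hv.one_le
  have hconv := hv.convexOn_sphere_sup hn hV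
  obtain ⟨C, D, hC1, hCD⟩ := hv.le_mul_add hn
  have hC0 : 0 < C := by linarith
  have hlin : ∀ a : ℝ, ∃ C' s : ℝ, ∀ x : 𝔼, exp s ≤ ‖x‖ → a * log ‖x‖ - C' ≤ v x := by
    intro a
    obtain ⟨t, s, ht, hts, hM⟩ := hcon (C * a)
    refine ⟨(C * a * s - V s + D) / C, max s (log (2 * R)), fun x hx => ?_⟩
    have hx0 : 0 < ‖x‖ := (exp_pos _).trans_le hx
    have hx1 : max s (log (2 * R)) ≤ log ‖x‖ := (Real.le_log_iff_exp_le hx0).2 hx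
    have hx2 : 2 * R ≤ ‖x‖ :=
      (Real.log_le_log_iff (by positivity) hx0).1 ((le_max_right _ _).trans hx1)
    obtain ⟨y, hy, hyV⟩ := (hV (log ‖x‖)).2
    rw [Real.exp_log hx0] at hy
    have h1 := hCD y x hy hx2
    have h2 := hconv.add_mul_sub_le ht hts hM.le ((le_max_left _ _).trans hx1)
    rw [hyV] at h1
    have h3 : C * ((C * a * s - V s + D) / C) = C * a * s - V s + D := mul_div_cancel₀ _ hC0.ne'
    refine le_of_mul_le_mul_left ?_ hC0
    rw [mul_sub, h3]
    linarith
  obtain ⟨C', s, hC'⟩ := hlin (n + 1)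
  obtain ⟨T, K, -, hT0, hRT, hext⟩ := hv.log_lower_extend hn (lt_add_one (n : ℝ)) hC' 0
  obtain ⟨x, hx⟩ := exists_norm_eq_exp hn (T + 1)
  set m := n * T - log A with hm
  set a := max 2 (v x - m + K + 1) with ha
  obtain ⟨C₂, s₂, h₂⟩ := hlin (a + 1)
  have h3 := hext a (a * T - m) (le_max_left _ _) (fun y hy => by
    have h4 := hv.log_le (hRT.trans hy.ge)
    rw [hy, Real.log_exp] at h4
    linarith) ⟨a + 1, C₂, s₂, lt_add_one a, h₂⟩ x (by rw [hx, Real.exp_le_exp]; linarith)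
  rw [hx, Real.log_exp] at h3
  have h4 : v x - m + K + 1 ≤ a := le_max_right _ _
  linarith

/-- Logarithmic asymptotics of an exterior solution with finite mass. -/
theorem IsExteriorSol.exists_log_asymptotics (hn : 2 ≤ n) {R A : ℝ} {v : 𝔼 → ℝ}
    (hv : IsExteriorSol R A v) (hint : IntegrableOn (fun x => exp (-v x)) {x | R < ‖x‖}) :
    ∃ c T C : ℝ, (n : ℝ) < c ∧ ∀ x, exp T ≤ ‖x‖ → |v x - c * log ‖x‖| ≤ C := by
  have hR : 0 < R := zero_lt_one.trans_le hv.one_le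
  have hn2 : (2 : ℝ) ≤ n := by exact_mod_cast hn
  obtain ⟨V, hV⟩ := exists_sphere_sup hn hv.contDiff.continuous
  have hconv := hv.convexOn_sphere_sup hn hV
  obtain ⟨M, hM⟩ := hv.bddAbove_slope hn hV
  have hvV : ∀ x, 0 < ‖x‖ → v x ≤ V (log ‖x‖) := fun x hx => (hV _).1 x (Real.exp_log hx).symm
  set S : Set ℝ := {a | ∃ t s, log R ≤ t ∧ t < s ∧ a = (V s - V t) / (s - t)} with hS
  have hSne : S.Nonempty := ⟨_, log R, log R + 1, le_rfl, lt_add_one _, rfl⟩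
  have hSb : BddAbove S := by
    refine ⟨M, ?_⟩
    rintro a ⟨t, s, ht, hts, rfl⟩
    exact (div_le_iff₀ (sub_pos.2 hts)).2 (hM t s ht hts)
  set c := sSup S with hc
  have hle : ∀ t s, log R ≤ t → t ≤ s → V s ≤ V t + c * (s - t) := by
    intro t s ht hts
    rcases hts.eq_or_lt with rfl | hts
    · simp
    have h1 : (V s - V t) / (s - t) ≤ c := le_csSup hSb ⟨t, s, ht, hts, rfl⟩
    have := (div_le_iff₀ (sub_pos.2 hts)).1 h1
    linarith
  have hgt : ∀ a < c, ∃ t s, log R ≤ t ∧ t < s ∧ a * (s - t) ≤ V s - V t := by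
    intro a ha
    obtain ⟨_, ⟨t, s, ht, hts, rfl⟩, hlt⟩ := exists_lt_of_lt_csSup hSne ha
    exact ⟨t, s, ht, hts, ((lt_div_iff₀ (sub_pos.2 hts)).1 hlt).le⟩
  -- the growth rate is at least critical
  have hcn : (n : ℝ) < c := by
    by_contra! hcn
    refine not_integrableOn_exp_neg hn hv.contDiff.continuous (T := log R)
      (C := V (log R) - n * log R) (fun x hx => ?_) ?_
    · have hx0 : 0 < ‖x‖ := (exp_pos _).trans_le hx
      have hx1 := (Real.le_log_iff_exp_le hx0).2 hx
      have h1 := hle _ _ le_rfl hx1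
      have h2 := hvV x hx0
      have h3 := mul_le_mul_of_nonneg_right hcn (sub_nonneg.2 hx1)
      linarith
    · rwa [Real.exp_log hR]
  have hc0 : 0 < c := by linarith
  obtain ⟨t₀, s₀, ht₀, hts₀, hpos⟩ := hgt 0 hc0
  have hmono := hconv.monotoneOn_of_slope_nonneg ht₀ hts₀ (by linarith)
  -- sharp Harnack inequality
  obtain ⟨D, s₁, hs₁, hD⟩ : ∃ D s₁ : ℝ, log R ≤ s₁ ∧
      ∀ x, exp s₁ ≤ ‖x‖ → V (log ‖x‖) - D ≤ v x := by
    have hA := hv.decay_pos hn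
    obtain ⟨C, hC1, hC⟩ := sphere_harnack hn (by positivity : 0 ≤ A * 2 ^ n)
    have hl2 : 0 < log 2 := Real.log_pos one_lt_two
    refine ⟨C * (c * log 2 + 1), max (s₀ + log 2) (log R + log 2),
      (by linarith : log R ≤ log R + log 2).trans (le_max_right _ _), fun x hx => ?_⟩
    have hx0 : 0 < ‖x‖ := (exp_pos _).trans_le hx
    have hx1 := (Real.le_log_iff_exp_le hx0).2 hx
    have hx2 : s₀ + log 2 ≤ log ‖x‖ := (le_max_left _ _).trans hx1
    have hx3 : log R + log 2 ≤ log ‖x‖ := (le_max_right _ _).trans hx1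
    have hxR : 2 * R ≤ ‖x‖ := by
      rw [← Real.log_mul hR.ne' two_ne_zero, Real.log_le_log_iff (by positivity) hx0] at hx3
      linarith
    have hann := hv.annulus_subset (n := n) hxR
    obtain ⟨z, hz, hzV⟩ := (hV (log ‖x‖)).2
    rw [Real.exp_log hx0] at hz
    have hlog2 : log (2 * ‖x‖) = log 2 + log ‖x‖ := Real.log_mul two_ne_zero hx0.ne'
    have h1 := hC (fun y => V (log (2 * ‖x‖)) - v y) (fun y => exp (-v y)) ‖x‖ hx0
      (contDiff_const.sub hv.contDiff) hv.contDiff.continuous.neg.rexp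
      (by simpa only [neg_neg] using (hv.weakSol.mono hann).const_sub (V (log (2 * ‖x‖))))
      (fun y hy => by
        have hy0 : 0 < ‖y‖ := by linarith [hy.1]
        have h3 : log ‖x‖ - log 2 ≤ log ‖y‖ := by
          rw [← Real.log_div hx0.ne' two_ne_zero]
          exact Real.log_le_log (by positivity) hy.1.le
        have h4 : log ‖y‖ ≤ log (2 * ‖x‖) := Real.log_le_log hy0 hy.2.le
        have h5 : s₀ ≤ log ‖y‖ := by linarith
        exact sub_nonneg.2 ((hvV y hy0).trans (hmono h5 (h5.trans h4) h4)))
      (fun y hy => by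
        rw [abs_of_pos (exp_pos _)]; exact hv.exp_neg_le_of_mem_annulus hxR hy) x z rfl hz
    simp only [hzV] at h1
    have h2 := hle (log ‖x‖) (log (2 * ‖x‖)) (by linarith) (by linarith)
    have h3 : C * (V (log (2 * ‖x‖)) - V (log ‖x‖) + 1) ≤ C * (c * log 2 + 1) := by
      refine mul_le_mul_of_nonneg_left ?_ (by linarith)
      rw [hlog2] at h2 ⊢
      linarith
    have h4 : s₀ ≤ log ‖x‖ := by linarith
    have h5 : log ‖x‖ ≤ log (2 * ‖x‖) := by linarith
    have h6 := hmono h4 (h4.trans h5) h5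
    linarith
  have hlow : ∀ a < c, ∃ C s : ℝ, ∀ x, exp s ≤ ‖x‖ → a * log ‖x‖ - C ≤ v x := by
    intro a ha
    obtain ⟨t, s, ht, hts, h1⟩ := hgt a ha
    refine ⟨a * s - V s + D, max s s₁, fun x hx => ?_⟩
    have hx0 : 0 < ‖x‖ := (exp_pos _).trans_le hx
    have hx1 := (Real.le_log_iff_exp_le hx0).2 hx
    have h2 := hconv.add_mul_sub_le ht hts h1 ((le_max_left _ _).trans hx1)
    have h3 := hD x ((Real.exp_le_exp.2 (le_max_right _ _)).trans hx)
    linarith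
  obtain ⟨b, hnb, hbc⟩ := exists_between hcn
  obtain ⟨C, s, hCs⟩ := hlow b hbc
  obtain ⟨T, K, hT1, hT0, hRT, hext⟩ := hv.log_lower_extend hn hnb hCs s₁
  set m := n * T - log A with hm
  refine ⟨c, T, max (V T - c * T) (c * T - m + K), hcn, fun x hx => abs_le'.2 ⟨?_, ?_⟩⟩
  · have hx0 : 0 < ‖x‖ := (exp_pos _).trans_le hx
    have h1 := hle T (log ‖x‖) (hs₁.trans hT1) ((Real.le_log_iff_exp_le hx0).2 hx)
    have h2 := hvV x hx0
    exact le_trans (by linarith) (le_max_left _ _)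
  · have hlim : Tendsto (fun a => a * log ‖x‖ - (c * T - m) - K) (𝓝[<] c)
        (𝓝 (c * log ‖x‖ - (c * T - m) - K)) := by
      refine Tendsto.mono_left (Continuous.tendsto ?_ c) nhdsWithin_le_nhds
      fun_prop
    have h1 : c * log ‖x‖ - (c * T - m) - K ≤ v x := by
      refine le_of_tendsto hlim ?_
      filter_upwards [Ico_mem_nhdsLT (hn2.trans_lt hcn)] with a ha
      obtain ⟨a', haa', ha'c⟩ := exists_between ha.2
      obtain ⟨C', s', h'⟩ := hlow a' ha'c
      refine hext a _ ha.1 (fun y hy => ?_) ⟨a', C', s', haa', h'⟩ x hx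
      have h4 := hv.log_le (hRT.trans hy.ge)
      rw [hy, Real.log_exp] at h4
      have h5 := mul_le_mul_of_nonneg_right ha.2.le hT0
      linarith
    exact le_trans (by linarith) (le_max_right _ _)

end ExteriorAsymptotics

section Reduction

variable {n : ℕ}

local notation "𝔼" => EuclideanSpace ℝ (Fin n)

/-- Multiplication by a cutoff makes `u` globally `C¹` without changing it near infinity. -/
lemma exists_contDiff_eq_off_ball {R : ℝ} (hR : 0 < R) {Ω : Set 𝔼} (hΩ : IsOpen Ω)
    (hcompl : (ball (0 : 𝔼) R)ᶜ ⊆ Ω) {u : 𝔼 → ℝ} (hu : ContDiffOn ℝ 1 u Ω) :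
    ∃ v : 𝔼 → ℝ, ContDiff ℝ 1 v ∧ ∀ x, R + 2 ≤ ‖x‖ → v x = u x := by
  let χ : ContDiffBump (0 : 𝔼) := ⟨R + 1, R + 2, by linarith, by linarith⟩
  refine ⟨fun x => (1 - χ x) * u x, ?_, fun x hx => ?_⟩
  · refine contDiff_of_zero_off (K := {x | R + 1 ≤ ‖x‖}) hΩ
      (isClosed_le continuous_const continuous_norm) (fun x hx => hcompl ?_)
      ((contDiff_const.sub χ.contDiff).contDiffOn.mul hu) (fun x hx => ?_)
    · have hx' : R + 1 ≤ ‖x‖ := hx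
      rw [mem_compl_iff, mem_ball_zero_iff]
      linarith
    · have hx' : ‖x‖ < R + 1 := not_le.1 hx
      rw [χ.one_of_mem_closedBall (mem_closedBall_zero_iff.2 hx'.le), sub_self, zero_mul]
  · have h1 : χ x = 0 := χ.zero_of_le_dist (by rw [dist_zero_right]; exact hx)
    simp only [h1, sub_zero, one_mul]

lemma IsWeakNSol.weakSol {Ω U : Set 𝔼} {u f v g : 𝔼 → ℝ} (h : IsWeakNSol n Ω u f)
    (hU : IsOpen U) (hUΩ : U ⊆ Ω) (huv : ∀ x ∈ U, v x = u x) (hfg : ∀ x ∈ U, g x = f x) :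
    WeakSol U v g := by
  intro φ hφ hc hs
  have hfd : ∀ x, x ∉ tsupport φ → fderiv ℝ φ x = 0 := fun x hx =>
    image_eq_zero_of_notMem_tsupport (fun h => hx (tsupport_fderiv_subset ℝ h))
  have h1 := h φ hφ hc (hs.trans hUΩ)
  have e1 : ∀ x, ⟪gradient u x, gradient φ x⟫_ℝ = fderiv ℝ φ x (gradient u x) := fun x => by
    rw [real_inner_comm, inner_gradient_left]
  simp only [e1] at h1
  rw [setIntegral_eq_integral_of_forall_compl_eq_zero
      (fun x hx => by rw [hfd x fun hx' => hx (hUΩ (hs hx'))]; simp),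
    setIntegral_eq_integral_of_forall_compl_eq_zero
      (fun x hx => by
        rw [image_eq_zero_of_notMem_tsupport fun hx' => hx (hUΩ (hs hx')), mul_zero])] at h1
  have e2 : nPairing v φ = nPairing u φ := by
    refine integral_congr_ae (Eventually.of_forall fun x => ?_)
    by_cases hx : x ∈ tsupport φ
    · have h2 : v =ᶠ[𝓝 x] u := by
        filter_upwards [hU.mem_nhds (hs hx)] with y hy using huv y hy
      have h3 : gradient v x = gradient u x := by
        unfold gradient; rw [h2.fderiv_eq]
      simp only [h3]
    · simp [hfd x hx]
  rw [e2]
  refine h1.trans (integral_congr_ae (Eventually.of_forall fun x => ?_))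
  by_cases hx : x ∈ tsupport φ
  · simp only [hfg x (hs hx)]
  · simp [image_eq_zero_of_notMem_tsupport hx]

lemma omegaN_pos (n : ℕ) : 0 < omegaN n :=
  ENNReal.toReal_pos (measure_ball_pos _ _ one_pos).ne' measure_ball_lt_top.ne

end Reduction

theorem log_asymptotics_at_infinity
    (n : ℕ) (hn : 2 ≤ n) (R : ℝ) (hR : 0 < R)
    (Ω : Set (EuclideanSpace ℝ (Fin n))) (hΩ : IsOpen Ω)
    (hΩub : ¬ Bornology.IsBounded Ω)
    (hcompl : (ball (0 : EuclideanSpace ℝ (Fin n)) R)ᶜ ⊆ Ω)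
    (u : EuclideanSpace ℝ (Fin n) → ℝ)
    (hu : ContDiffOn ℝ 1 u Ω)
    (hsol : IsWeakNSol n Ω u (fun x => Real.exp (u x)))
    (hint : IntegrableOn (fun x => Real.exp (u x)) Ω) :
    ∃ γinf : ℝ, γinf > (n : ℝ) ^ n * omegaN n ∧
      ∃ R' : ℝ, R' ≥ R ∧ ∃ C : ℝ, 0 < C ∧
        ∀ x : EuclideanSpace ℝ (Fin n), R' ≤ ‖x‖ →
          |u x + (γinf / ((n : ℝ) * omegaN n)) ^ ((1 : ℝ) / ((n : ℝ) - 1)) * Real.log ‖x‖|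
            ≤ C := by
  obtain ⟨w, hw, hwu⟩ := exists_contDiff_eq_off_ball hR hΩ hcompl hu
  have hU : ∀ r : ℝ, IsOpen {x : EuclideanSpace ℝ (Fin n) | r < ‖x‖} := fun r =>
    isOpen_lt continuous_const continuous_norm
  have hUΩ : {x : EuclideanSpace ℝ (Fin n) | R + 2 < ‖x‖} ⊆ Ω := fun x hx => hcompl (by
    have hx' : R + 2 < ‖x‖ := hx
    rw [mem_compl_iff, mem_ball_zero_iff]; linarith)
  have hws : WeakSol {x | R + 2 < ‖x‖} w (fun x => exp (w x)) :=
    hsol.weakSol (hU _) hUΩ (fun x hx => hwu x (le_of_lt hx))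
      (fun x hx => by rw [hwu x (le_of_lt hx)])
  have hwi : IntegrableOn (fun x => exp (w x)) {x | R + 2 < ‖x‖} :=
    (hint.mono_set hUΩ).congr_fun (fun x hx => by simp only [hwu x (le_of_lt hx)])
      (hU _).measurableSet
  obtain ⟨R₁, hR₁, h1R₁, hdec⟩ := exp_mul_norm_pow_le hn hw hws hwi
  have hsub : {x : EuclideanSpace ℝ (Fin n) | R₁ < ‖x‖} ⊆ {x | R + 2 < ‖x‖} :=
    fun x hx => hR₁.trans_lt hx
  have hv : IsExteriorSol R₁ (4 ^ n) (fun x => -w x) :=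
    { contDiff := hw.neg
      weakSol := by simpa using (hws.mono hsub).const_sub 0
      decay := by simpa using hdec
      one_le := h1R₁ }
  obtain ⟨c, T, C, hc, hC⟩ := hv.exists_log_asymptotics hn
    (by simpa using hwi.mono_set hsub)
  have hn2 : (2 : ℝ) ≤ n := by exact_mod_cast hn
  have hc0 : 0 < c := by linarith
  have hω := omegaN_pos n
  have hγ : (c ^ (n - 1) * (n * omegaN n) / (n * omegaN n)) ^ ((1 : ℝ) / ((n : ℝ) - 1)) = c := by
    rw [mul_div_cancel_right₀ _ (by positivity), one_div,
      show (n : ℝ) - 1 = ((n - 1 : ℕ) : ℝ) by rw [Nat.cast_sub (by omega)]; simp]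
    exact Real.pow_rpow_inv_natCast hc0.le (by omega)
  refine ⟨c ^ (n - 1) * (n * omegaN n), ?_, max (R + 2) (exp T),
    (by linarith : R ≤ R + 2).trans (le_max_left _ _), max C 1, by positivity, fun x hx => ?_⟩
  · rw [gt_iff_lt, ← mul_assoc]
    refine mul_lt_mul_of_pos_right ?_ hω
    calc (n : ℝ) ^ n = (n : ℝ) ^ (n - 1) * n := by rw [← pow_succ]; congr 1; omega
      _ < c ^ (n - 1) * n := by
        refine mul_lt_mul_of_pos_right ?_ (by linarith)
        exact pow_lt_pow_left₀ hc (by linarith) (by omega)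
  · have h1 := hC x ((le_max_right _ _).trans hx)
    rw [hγ, ← hwu x ((le_max_left _ _).trans hx), ← abs_neg]
    refine (le_of_eq ?_).trans (h1.trans (le_max_left _ _))
    congr 1; ring
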